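/- Let ⟨,⟩ be a symplectic form on V and let N, N' be nilpotent endomorphisms of V with 1+N ∈ Sp(⟨,⟩), 1+N' ∈ Sp(⟨,⟩), V^N_* = V^{N'}_*, and N − N' ∈ E_{≥3}V^N_* (i.e. N and N' induce the same maps on the graded pieces of V^N_*). Then there exists g ∈ Sp(⟨,⟩) with g(V^N_{≥a}) = V^N_{≥a} for all a ∈ ℤ and N' = g∘N∘g^{−1}. -/

import Mathlib

/-- The canonical (Dynkin–Kostant) filtration attached to a nilpotent endomorphism:
`V^N_{≥a} = Σ_{j ≥ max(0,a)} N^j (ker N^{2j−a+1})`. -/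
noncomputable def canonFilt {k : Type*} [Field k] {V : Type*} [AddCommGroup V] [Module k V]
    (N : V →ₗ[k] V) (a : ℤ) : Submodule k V :=
  ⨆ j : {j : ℕ // a ≤ (j : ℤ)},
    Submodule.map (N ^ (j : ℕ)) (LinearMap.ker (N ^ (2 * ((j : ℕ) : ℤ) - a + 1).toNat))

section Poly

open Polynomial

variable {k : Type*} [Field k]

/-- Hensel's lemma for a quadratic equation over `k[X]`, truncated at order `M`. -/
lemma exists_X_pow_dvd_quadratic (a b c : k[X]) (y₀ : k)
    (h₀ : a.coeff 0 * y₀ ^ 2 + b.coeff 0 * y₀ + c.coeff 0 = 0)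
    (h₁ : 2 * a.coeff 0 * y₀ + b.coeff 0 ≠ 0) (M : ℕ) :
    ∃ y : k[X], X ^ M ∣ a * y ^ 2 + b * y + c := by
  suffices ∃ y : k[X], y.coeff 0 = y₀ ∧ X ^ (M + 1) ∣ a * y ^ 2 + b * y + c by
    obtain ⟨y, -, hy⟩ := this
    exact ⟨y, (pow_dvd_pow X (Nat.le_succ M)).trans hy⟩
  induction M with
  | zero =>
    refine ⟨C y₀, by simp, ?_⟩
    rw [zero_add, pow_one, X_dvd_iff]
    simpa [mul_coeff_zero, pow_two] using h₀
  | succ M ih =>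
    obtain ⟨y, hy, r, hr⟩ := ih
    let e := -(r.coeff 0) / (2 * a.coeff 0 * y₀ + b.coeff 0)
    have hz : X ∣ r + C e * (2 * a * y + b) := by
      rw [X_dvd_iff]
      simp only [coeff_add, mul_coeff_zero, coeff_C_zero, hy, coeff_ofNat_zero]
      rw [div_mul_cancel₀ _ h₁]
      ring
    obtain ⟨t, ht⟩ := hz
    refine ⟨y + C e * X ^ (M + 1), by simp [hy], t + X ^ M * (a * C e ^ 2), ?_⟩
    linear_combination hr + X ^ (M + 1) * ht

lemma exists_X_pow_dvd_mul_sub_one (w : k[X]) (hw : w.coeff 0 ≠ 0) (M : ℕ) :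
    ∃ v : k[X], X ^ M ∣ v * w - 1 := by
  obtain ⟨v, hv⟩ := exists_X_pow_dvd_quadratic 0 w (-1) (w.coeff 0)⁻¹ (by simp [hw])
    (by simpa using hw) M
  exact ⟨v, by convert hv using 1; ring⟩

/-- Every unit of `k[X]/(X^M)` is a norm from the extension by a root of `t² = X t + X`. -/
lemma exists_X_pow_dvd_norm_sub [IsAlgClosed k] (v : k[X]) (hv : v.coeff 0 ≠ 0) (M : ℕ) :
    ∃ a b : k[X], X ^ M ∣ a ^ 2 + a * b * X - b ^ 2 * X - v := by
  obtain ⟨α, hα⟩ := IsAlgClosed.exists_pow_nat_eq (v.coeff 0) (n := 2) (by norm_num)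
  have hα₀ : α ≠ 0 := by rintro rfl; exact hv (by simpa using hα.symm)
  by_cases h2 : (2 : k) = 0
  · obtain ⟨v₁, hv₁⟩ : X ∣ v - C (α ^ 2) := by rw [X_dvd_iff]; simp [hα]
    obtain ⟨y₀, hy₀⟩ := IsAlgClosed.exists_root (X ^ 2 + C (-α) * X + C (v₁.coeff 0) : k[X])
      (by rw [show (X ^ 2 + C (-α) * X + C (v₁.coeff 0) : k[X])
            = C 1 * X ^ 2 + C (-α) * X + C (v₁.coeff 0) by simp, degree_quadratic one_ne_zero]
          norm_num)
    simp only [IsRoot.def, eval_add, eval_pow, eval_X, eval_mul, eval_C] at hy₀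
    obtain ⟨b, hb⟩ := exists_X_pow_dvd_quadratic (-1) (C α) (-v₁) y₀
      (by simp; linear_combination -hy₀) (by simp [h2, hα₀]) M
    refine ⟨C α, b, hb.trans ⟨X, ?_⟩⟩
    rw [C_pow] at hv₁
    linear_combination -hv₁
  · obtain ⟨a, ha⟩ := exists_X_pow_dvd_quadratic 1 0 (-v) α (by simp [hα]) (by simp [h2, hα₀]) M
    exact ⟨a, 0, by convert ha using 1; ring⟩

lemma exists_coeff_mul_eq (l : k[X] →ₗ[k] k) (m : ℕ) (h : ∀ j, m < j → l (X ^ j) = 0) :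
    ∃ w : k[X], ∀ q, l q = (w * q).coeff m := by
  refine ⟨∑ i ∈ Finset.range (m + 1), C (l (X ^ (m - i))) * X ^ i, fun q => ?_⟩
  induction q using Polynomial.induction_on' with
  | add p q hp hq => rw [map_add, hp, hq, mul_add, coeff_add]
  | monomial n a =>
    rw [← C_mul_X_pow_eq_monomial, ← smul_eq_C_mul, map_smul, mul_smul_comm, coeff_smul,
      coeff_mul_X_pow']
    congr 1
    split_ifs with hn
    · simp only [finsetSum_coeff, coeff_C_mul, coeff_X_pow]
      rw [Finset.sum_eq_single (m - n)]
      · simp [Nat.sub_sub_self hn]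
      · intro b _ hb
        simp [hb.symm]
      · intro hb
        exact absurd (Finset.mem_range.2 (by omega)) hb
    · exact h n (by omega)

lemma X_pow_dvd_of_coeff_mul_eq_zero (p : k[X]) (m : ℕ) (h : ∀ q, (p * q).coeff m = 0) :
    X ^ (m + 1) ∣ p := by
  rw [X_pow_dvd_iff]
  intro d hd
  have := h (X ^ (m - d))
  rwa [coeff_mul_X_pow', if_pos (by omega), Nat.sub_sub_self (by omega)] at this

lemma coeff_eq_of_X_pow_dvd_sub {p p' : k[X]} {m : ℕ} (h : X ^ (m + 1) ∣ p - p') :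
    p.coeff m = p'.coeff m := by
  have := (X_pow_dvd_iff.1 h) m (by omega)
  rwa [coeff_sub, sub_eq_zero] at this

end Poly

section Pairs

open Polynomial

variable {k V : Type*} [Field k] [AddCommGroup V] [Module k V]

/-- A symplectic form `B` with a nilpotent `N` such that `1 + N` is an isometry, recorded through
the self-adjoint operator `s = N + N*`, which satisfies `N² = s N + s`. -/
structure SpPair (B : V →ₗ[k] V →ₗ[k] k) (s N : Module.End k V) : Prop where
  alt : ∀ x, B x x = 0
  nondeg : ∀ x, (∀ y, B x y = 0) → x = 0
  nil : IsNilpotent s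
  comm : ∀ x, N (s x) = s (N x)
  sq : ∀ x, N (N x) = s (N x) + s x
  adj_s : ∀ x y, B (s x) y = B x (s y)
  adj_N : ∀ x y, B (N x) y = B x (s y) - B x (N y)

/-- The map `(a, b) ↦ a(s) x + b(s) N x` onto the cyclic submodule generated by `x`. -/
noncomputable def cyc (s N : Module.End k V) (x : V) : (k[X] × k[X]) →ₗ[k] V where
  toFun p := aeval s p.1 x + aeval s p.2 (N x)
  map_add' p q := by simp only [Prod.fst_add, Prod.snd_add, map_add, LinearMap.add_apply]; abel
  map_smul' c p := by simp

lemma cyc_apply (s N : Module.End k V) (x : V) (a b : k[X]) :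
    cyc s N x (a, b) = aeval s a x + aeval s b (N x) := rfl

lemma s_cyc (s N : Module.End k V) (x : V) (p : k[X] × k[X]) :
    s (cyc s N x p) = cyc s N x (X * p.1, X * p.2) := by
  simp [cyc]

lemma aeval_cyc (s N : Module.End k V) (q : k[X]) (x : V) (a b : k[X]) :
    aeval s q (cyc s N x (a, b)) = cyc s N x (q * a, q * b) := by
  simp [cyc]

lemma aeval_eq_zero_of_X_pow_dvd {s : Module.End k V} {m : ℕ} (hs : s ^ m = 0) {p : k[X]}
    (h : X ^ m ∣ p) : aeval s p = 0 := by
  obtain ⟨q, rfl⟩ := h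
  simp [hs]

lemma eq_zero_of_forall_right {B : V →ₗ[k] V →ₗ[k] k} {s N : Module.End k V}
    (H : SpPair B s N) {y : V} (h : ∀ x, B x y = 0) : y = 0 :=
  H.nondeg y fun x => by
    have := H.alt (x + y)
    simp only [map_add, LinearMap.add_apply, H.alt, h] at this
    simpa using this

namespace SpPair

variable {B : V →ₗ[k] V →ₗ[k] k} {s N : Module.End k V} (H : SpPair B s N)
include H

lemma neg (x y : V) : B x y = -B y x := by
  have := H.alt (x + y)
  simp only [map_add, LinearMap.add_apply, H.alt] at this
  linear_combination this

lemma comm_aeval (p : k[X]) (x : V) : N (aeval s p x) = aeval s p (N x) := by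
  have h : Commute s N := by ext x; simp [H.comm]
  have : Commute (aeval s p) N := by
    induction p using Polynomial.induction_on' with
    | add p q hp hq => rw [map_add]; exact hp.add_left hq
    | monomial n a =>
      rw [aeval_monomial]
      exact (show Commute _ N from Algebra.commutes a N).mul_left (h.pow_left n)
  exact (LinearMap.congr_fun this.eq x).symm

lemma comm_pow (i : ℕ) (x : V) : N ((s ^ i) x) = (s ^ i) (N x) := by
  simpa using H.comm_aeval (X ^ i) x

lemma adj_aeval (p : k[X]) (x y : V) : B (aeval s p x) y = B x (aeval s p y) := by
  induction p using Polynomial.induction_on' with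
  | add p q hp hq => simp [hp, hq]
  | monomial n a =>
    have : ∀ x y, B ((s ^ n) x) y = B x ((s ^ n) y) := by
      induction n with
      | zero => simp
      | succ n ih =>
        intro x y
        rw [pow_succ', Module.End.mul_apply, H.adj_s, ih, ← Module.End.mul_apply, ← pow_succ,
          pow_succ']
    simp [aeval_monomial, this]

lemma adj_pow (i : ℕ) (x y : V) : B ((s ^ i) x) y = B x ((s ^ i) y) := by
  simpa using H.adj_aeval (X ^ i) x y

lemma self_s (x : V) : B x (s x) = 0 := by
  have h := H.adj_N x x
  rw [H.neg (N x) x] at h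
  linear_combination -h

lemma self_aeval (p : k[X]) (x : V) : B x (aeval s p x) = 0 := by
  induction p using Polynomial.induction_on' with
  | add p q hp hq => simp [hp, hq]
  | monomial n a =>
    rw [aeval_monomial, Module.End.mul_apply, Module.algebraMap_end_apply, map_smul]
    obtain ⟨j, rfl | rfl⟩ := n.even_or_odd'
    · rw [two_mul, pow_add, Module.End.mul_apply, ← H.adj_pow, H.alt, smul_zero]
    · rw [show 2 * j + 1 = j + (1 + j) by ring, pow_add, Module.End.mul_apply, ← H.adj_pow,
        pow_add, Module.End.mul_apply, pow_one, H.self_s, smul_zero]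

lemma N_cyc (x : V) (p : k[X] × k[X]) :
    N (cyc s N x p) = cyc s N x (X * p.2, p.1 + X * p.2) := by
  simp only [cyc, LinearMap.coe_mk, AddHom.coe_mk, map_add, H.comm_aeval, H.sq, map_mul, aeval_X,
    Module.End.mul_apply, LinearMap.add_apply]
  have e : ∀ z, aeval s p.2 (s z) = s (aeval s p.2 z) := fun z => by
    have := congrArg (fun q => aeval s q z) (mul_comm p.2 X)
    simpa using this
  rw [e, e]
  abel

lemma gram (x y : V) (a b c d : k[X]) :
    B (cyc s N x (a, b)) (cyc s N y (c, d)) =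
      B x (aeval s (a * c + X * b * c - X * b * d) y) + B x (aeval s (a * d - b * c) (N y)) := by
  have h : ∀ w, B (cyc s N x (a, b)) w =
      B x (aeval s a w + s (aeval s b w) - N (aeval s b w)) := fun w => by
    rw [cyc_apply, map_add, LinearMap.add_apply, H.adj_aeval, H.adj_aeval, H.adj_N, map_sub,
      map_add]
    ring
  rw [h, ← map_add]
  congr 1
  rw [aeval_cyc, aeval_cyc, H.N_cyc, s_cyc, ← map_add, ← map_sub, ← cyc_apply]
  congr 1
  ext1 <;> simp
  ring

end SpPair
end Pairs

section NormalForms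

open Polynomial

variable {k V : Type*} [Field k] [AddCommGroup V] [Module k V]
variable {B : V →ₗ[k] V →ₗ[k] k} {s N : Module.End k V}

lemma exists_form_aeval_eq_coeff (B : V →ₗ[k] V →ₗ[k] k) {m : ℕ} (hs : s ^ (m + 1) = 0)
    (x z : V) : ∃ w : k[X], ∀ q : k[X], B x (aeval s q z) = (w * q).coeff m := by
  let l : k[X] →ₗ[k] k := (B x) ∘ₗ (LinearMap.applyₗ z) ∘ₗ (aeval s).toLinearMap
  refine exists_coeff_mul_eq l m fun j hj => ?_
  have : s ^ j = 0 := pow_eq_zero_of_le hj hs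
  simp [l, this]

lemma coeff_zero_of_form_aeval {m : ℕ} {x z : V} {w : k[X]}
    (hw : ∀ q : k[X], B x (aeval s q z) = (w * q).coeff m) : w.coeff 0 = B x ((s ^ m) z) := by
  have := hw (X ^ m)
  rw [coeff_mul_X_pow', if_pos le_rfl, Nat.sub_self] at this
  simpa using this.symm

namespace SpPair

variable (H : SpPair B s N)
include H

omit H in
lemma form_cyc_right (x y : V) (c d : k[X]) :
    B x (cyc s N y (c, d)) = B x (aeval s c y) + B x (aeval s d (N y)) := by
  rw [cyc_apply, map_add]

lemma aeval_N_cyc (q : k[X]) (y : V) (a b : k[X]) :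
    aeval s q (N (cyc s N y (a, b))) = cyc s N y (q * (X * b), q * (a + X * b)) := by
  rw [H.N_cyc, aeval_cyc]

lemma form_N_cyc (x : V) (a b q : k[X]) :
    B (cyc s N x (a, b)) (aeval s q (N (cyc s N x (a, b)))) =
      B x (aeval s ((a ^ 2 + a * b * X - b ^ 2 * X) * q) (N x)) := by
  rw [H.aeval_N_cyc, H.gram, H.self_aeval, zero_add]
  congr 3
  ring

lemma form_N_add_cyc (x y : V) (a b q : k[X]) :
    B (x + cyc s N y (a, b)) (aeval s q (N (x + cyc s N y (a, b)))) =
      B x (aeval s q (N x)) + B y (aeval s ((a ^ 2 + a * b * X - b ^ 2 * X) * q) (N y)) +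
      B x (aeval s ((2 * X * b - X * a) * q) y) + B x (aeval s ((2 * a + X * b) * q) (N y)) := by
  have h1 : B (cyc s N y (a, b)) (aeval s q (N x)) =
      -(B x (aeval s (X * q * a - X * q * b) y) - B x (aeval s (q * a) (N y))) := by
    rw [H.neg, show aeval s q (N x) = cyc s N x (0, q) by simp [cyc_apply], H.gram]
    simp
    ring
  have h2 : B x (aeval s q (N (cyc s N y (a, b)))) =
      B x (aeval s (q * (X * b)) y) + B x (aeval s (q * (a + X * b)) (N y)) := by
    rw [H.aeval_N_cyc, form_cyc_right]
  have e1 : (2 * X * b - X * a) * q = q * (X * b) - (X * q * a - X * q * b) := by ring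
  have e2 : (2 * a + X * b) * q = q * (a + X * b) + q * a := by ring
  rw [e1, e2]
  simp only [map_add, map_sub, LinearMap.add_apply, LinearMap.sub_apply] at h1 h2 ⊢
  have h3 := H.form_N_cyc y a b q
  rw [h1, h2, h3]
  ring

lemma form_swap (x y : V) (q : k[X]) : B y (aeval s q x) = -B x (aeval s q y) := by
  rw [H.neg, H.adj_aeval]

lemma form_swap_N (x y : V) (q : k[X]) :
    B y (aeval s q (N x)) = B x (aeval s q (N y)) - B x (aeval s (q * X) y) := by
  rw [H.neg, H.adj_aeval, H.adj_N, H.comm_aeval, mul_comm]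
  simp

/-- `β(x, y) = B(x, s^m N y)` is symmetric when `s^(m+1) = 0`. -/
lemma top_symm {m : ℕ} (hs : s ^ (m + 1) = 0) (x y : V) :
    B y ((s ^ m) (N x)) = B x ((s ^ m) (N y)) := by
  have := H.form_swap_N x y (X ^ m)
  rw [← pow_succ] at this
  simpa [hs] using this

lemma top_cyc {m : ℕ} (hs : s ^ (m + 1) = 0) (x y : V) (a b : k[X]) :
    B (cyc s N x (a, b)) ((s ^ m) (N y)) = a.coeff 0 * B x ((s ^ m) (N y)) := by
  obtain ⟨w, hw⟩ := exists_form_aeval_eq_coeff B hs x (N y)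
  have e : (s ^ m) (N y) = cyc s N y (0, X ^ m) := by simp [cyc_apply]
  rw [← coeff_zero_of_form_aeval hw, e, H.gram, hw]
  have : aeval s (a * 0 + X * b * 0 - X * b * X ^ m) = 0 :=
    aeval_eq_zero_of_X_pow_dvd hs ⟨-b, by ring⟩
  rw [this]
  simp only [mul_zero, sub_zero, LinearMap.zero_apply, map_zero, zero_add]
  rw [← mul_assoc, coeff_mul_X_pow', if_pos le_rfl, Nat.sub_self, mul_coeff_zero, mul_comm]

/-- Normal form of a cyclic summand. -/
lemma exists_cyclic [IsAlgClosed k] {m : ℕ} (hs : s ^ (m + 1) = 0) (x : V)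
    (hx : B x ((s ^ m) (N x)) ≠ 0) :
    ∃ x' : V, (∀ q : k[X], B x' (aeval s q (N x')) = q.coeff m) ∧
      ∃ c : k, c ≠ 0 ∧ ∀ y, B x' ((s ^ m) (N y)) = c * B x ((s ^ m) (N y)) := by
  obtain ⟨w, hw⟩ := exists_form_aeval_eq_coeff B hs x (N x)
  have hw₀ := coeff_zero_of_form_aeval hw
  obtain ⟨v, hv⟩ := exists_X_pow_dvd_mul_sub_one w (hw₀ ▸ hx) (m + 1)
  have hv₀ : v.coeff 0 ≠ 0 := by
    intro h
    have := (X_dvd_iff (f := v * w - 1)).1 ((dvd_pow_self X (Nat.succ_ne_zero m)).trans hv)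
    simp [mul_coeff_zero, h] at this
  obtain ⟨a, b, hab⟩ := exists_X_pow_dvd_norm_sub v hv₀ (m + 1)
  have key : ∀ q : k[X], B (cyc s N x (a, b)) (aeval s q (N (cyc s N x (a, b)))) = q.coeff m := by
    intro q
    rw [H.form_N_cyc, hw]
    apply coeff_eq_of_X_pow_dvd_sub
    obtain ⟨r, hr⟩ := hab
    obtain ⟨t, ht⟩ := hv
    exact ⟨w * q * r + q * t, by linear_combination w * q * hr + q * ht⟩
  refine ⟨cyc s N x (a, b), key, a.coeff 0, fun h => ?_, fun y => H.top_cyc hs x y a b⟩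
  have := key (X ^ m)
  rw [coeff_X_pow_self, map_pow, aeval_X, H.top_cyc hs, h, zero_mul] at this
  exact zero_ne_one this

lemma exists_dual_even {m : ℕ} (hs : s ^ (m + 1) = 0) (x y : V)
    (hxy : B x ((s ^ m) (N y)) ≠ 0) :
    ∃ y' : V, (∀ q : k[X], B x (aeval s q y') = 0) ∧
      ∀ q : k[X], B x (aeval s q (N y')) = q.coeff m := by
  obtain ⟨g, hg⟩ := exists_form_aeval_eq_coeff B hs x y
  obtain ⟨h, hh⟩ := exists_form_aeval_eq_coeff B hs x (N y)
  have hh₀ := coeff_zero_of_form_aeval hh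
  obtain ⟨e, r, he⟩ := exists_X_pow_dvd_mul_sub_one (X * g * (g + h) - h ^ 2)
    (by simp [mul_coeff_zero, pow_two, hh₀, hxy]) (m + 1)
  refine ⟨cyc s N y (-e * h, e * g), fun q => ?_, fun q => ?_⟩
  · rw [aeval_cyc, form_cyc_right, hg, hh, ← coeff_add]
    convert coeff_zero m using 2
    ring
  · rw [H.aeval_N_cyc, form_cyc_right, hg, hh, ← coeff_add]
    apply coeff_eq_of_X_pow_dvd_sub
    exact ⟨q * r, by linear_combination q * he⟩

lemma exists_dual_odd {m : ℕ} (hs : s ^ (m + 1) = 0) (hN : ∀ x, (s ^ m) (N x) = 0) (x y : V)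
    (hxy : B x ((s ^ m) y) ≠ 0) :
    ∃ y' : V, (∀ q : k[X], B x (aeval s q y') = q.coeff m) ∧
      ∀ q : k[X], B x (aeval s q (N y')) = 0 := by
  obtain ⟨g, hg⟩ := exists_form_aeval_eq_coeff B hs x y
  obtain ⟨h, hh⟩ := exists_form_aeval_eq_coeff B hs x (N y)
  have hg₀ := coeff_zero_of_form_aeval hg
  obtain ⟨h₁, rfl⟩ : X ∣ h := by rw [X_dvd_iff, coeff_zero_of_form_aeval hh, hN, map_zero]
  obtain ⟨e, r, he⟩ := exists_X_pow_dvd_mul_sub_one (g ^ 2 + X * g * h₁ - X * h₁ ^ 2)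
    (by simp [mul_coeff_zero, pow_two, hg₀, hxy]) (m + 1)
  refine ⟨cyc s N y (e * (g + X * h₁), -e * h₁), fun q => ?_, fun q => ?_⟩
  · rw [aeval_cyc, form_cyc_right, hg, hh, ← coeff_add]
    apply coeff_eq_of_X_pow_dvd_sub
    exact ⟨q * r, by linear_combination q * he⟩
  · rw [H.aeval_N_cyc, form_cyc_right, hg, hh, ← coeff_add]
    convert coeff_zero m using 2
    ring

/-- Once `x` is isotropic, adding to `y` an element of the cyclic module of `x` does not change
the pairing with `x`. -/
lemma form_add_cyc_of_isotropic {x : V} (hx : ∀ q : k[X], B x (aeval s q (N x)) = 0) (y : V)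
    (a b q : k[X]) :
    B x (aeval s q (y + cyc s N x (a, b))) = B x (aeval s q y) ∧
      B x (aeval s q (N (y + cyc s N x (a, b)))) = B x (aeval s q (N y)) := by
  constructor
  · rw [map_add, map_add, aeval_cyc, form_cyc_right, hx, H.self_aeval]; simp
  · rw [map_add, map_add, map_add, H.aeval_N_cyc, form_cyc_right, hx, H.self_aeval]; simp

/-- Normal form of a hyperbolic summand with Jordan blocks of even size. -/
lemma exists_hyperbolic_even {m : ℕ} (hs : s ^ (m + 1) = 0)
    (halt : ∀ x, B x ((s ^ m) (N x)) = 0) (hne : ∃ x, (s ^ m) (N x) ≠ 0) :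
    ∃ x y : V, (∀ q : k[X], B x (aeval s q (N x)) = 0) ∧ (∀ q : k[X], B y (aeval s q (N y)) = 0) ∧
      (∀ q : k[X], B x (aeval s q y) = 0) ∧ ∀ q : k[X], B x (aeval s q (N y)) = q.coeff m := by
  have hX : ∀ x, ∃ v : k[X], ∀ q : k[X], B x (aeval s q (N x)) = (X * v * q).coeff m := fun x => by
    obtain ⟨w, hw⟩ := exists_form_aeval_eq_coeff B hs x (N x)
    obtain ⟨v, rfl⟩ : X ∣ w := by rw [X_dvd_iff, coeff_zero_of_form_aeval hw, halt]
    exact ⟨v, hw⟩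
  obtain ⟨y₀, hy₀⟩ := hne
  obtain ⟨x₀, hx₀⟩ : ∃ x, B x ((s ^ m) (N y₀)) ≠ 0 := by
    by_contra! h
    exact hy₀ (eq_zero_of_forall_right H h)
  obtain ⟨y₁, hg₁, hh₁⟩ := H.exists_dual_even hs x₀ y₀ hx₀
  obtain ⟨v, hv⟩ := hX x₀
  obtain ⟨w, hw⟩ := hX y₁
  obtain ⟨b, hb⟩ := exists_X_pow_dvd_quadratic (-(X * w)) 1 v (-(v.coeff 0)) (by simp) (by simp)
    (m + 1)
  obtain ⟨r, hr⟩ := hb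
  have hiso : ∀ q : k[X], B (x₀ + cyc s N y₁ (0, b))
      (aeval s q (N (x₀ + cyc s N y₁ (0, b)))) = 0 := by
    intro q
    rw [H.form_N_add_cyc, hv, hw, hg₁, hh₁, add_zero, ← coeff_add, ← coeff_add]
    refine (coeff_eq_of_X_pow_dvd_sub ?_).trans (coeff_zero m)
    exact ⟨X * q * r, by linear_combination X * q * hr⟩
  have hpair : B (x₀ + cyc s N y₁ (0, b)) ((s ^ m) (N y₁)) ≠ 0 := by
    have := hh₁ (X ^ m)
    rw [map_pow, aeval_X, coeff_X_pow_self] at this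
    rw [map_add, LinearMap.add_apply, H.top_cyc hs, this]
    simp
  generalize x₀ + cyc s N y₁ (0, b) = x₁ at hiso hpair
  obtain ⟨y₂, hg₂, hh₂⟩ := H.exists_dual_even hs x₁ y₁ hpair
  obtain ⟨u, hu⟩ := hX y₂
  refine ⟨x₁, y₂ + cyc s N x₁ (0, -u), hiso, fun q => ?_, fun q => ?_, fun q => ?_⟩
  · rw [H.form_N_add_cyc, hiso, hu, H.form_swap x₁, H.form_swap_N x₁, hg₂, hg₂, hh₂, neg_zero,
      sub_zero, add_zero, add_zero, ← coeff_add]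
    convert coeff_zero m using 2
    ring
  · rw [(H.form_add_cyc_of_isotropic hiso _ _ _ _).1, hg₂]
  · rw [(H.form_add_cyc_of_isotropic hiso _ _ _ _).2, hh₂]

/-- Normal form of a hyperbolic summand with Jordan blocks of odd size. -/
lemma exists_hyperbolic_odd {m : ℕ} [IsAlgClosed k] (hs : s ^ (m + 1) = 0)
    (hN : ∀ x, (s ^ m) (N x) = 0) (hne : ∃ x, (s ^ m) x ≠ 0) :
    ∃ x y : V, (∀ q : k[X], B x (aeval s q (N x)) = 0) ∧ (∀ q : k[X], B y (aeval s q (N y)) = 0) ∧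
      (∀ q : k[X], B x (aeval s q y) = q.coeff m) ∧ ∀ q : k[X], B x (aeval s q (N y)) = 0 := by
  have hX : ∀ x, ∃ v : k[X], ∀ q : k[X], B x (aeval s q (N x)) = (X * v * q).coeff m := fun x => by
    obtain ⟨w, hw⟩ := exists_form_aeval_eq_coeff B hs x (N x)
    obtain ⟨v, rfl⟩ : X ∣ w := by rw [X_dvd_iff, coeff_zero_of_form_aeval hw, hN, map_zero]
    exact ⟨v, hw⟩
  obtain ⟨y₀, hy₀⟩ := hne
  obtain ⟨x₀, hx₀⟩ : ∃ x, B x ((s ^ m) y₀) ≠ 0 := by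
    by_contra! h
    exact hy₀ (eq_zero_of_forall_right H h)
  obtain ⟨y₁, hg₁, hh₁⟩ := H.exists_dual_odd hs hN x₀ y₀ hx₀
  obtain ⟨v, hv⟩ := hX x₀
  obtain ⟨w, hw⟩ := hX y₁
  obtain ⟨a, b, r, hr⟩ : ∃ a b : k[X],
      X ^ (m + 1) ∣ v + w * (a ^ 2 + a * b * X - b ^ 2 * X) + 2 * b - a := by
    by_cases h2 : (2 : k) = 0
    · obtain ⟨y, hy⟩ : ∃ y : k, w.coeff 0 * y ^ 2 + -1 * y + v.coeff 0 = 0 := by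
        by_cases hw₀ : w.coeff 0 = 0
        · exact ⟨v.coeff 0, by rw [hw₀]; ring⟩
        · obtain ⟨y, hy⟩ := IsAlgClosed.exists_root
            (C (w.coeff 0) * X ^ 2 + C (-1) * X + C (v.coeff 0))
            (by rw [degree_quadratic hw₀]; norm_num)
          exact ⟨y, by simpa only [IsRoot.def, eval_add, eval_mul, eval_pow, eval_X, eval_C]
            using hy⟩
      obtain ⟨a, ha⟩ := exists_X_pow_dvd_quadratic w (-1) v y (by simpa using hy)
        (by simp [h2]) (m + 1)
      exact ⟨a, 0, by convert ha using 1; ring⟩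
    · obtain ⟨b, hb⟩ := exists_X_pow_dvd_quadratic (-(X * w)) 2 v (-(v.coeff 0) / 2)
        (by simp; field_simp; ring) (by simpa using h2) (m + 1)
      exact ⟨0, b, by convert hb using 1; ring⟩
  have hiso : ∀ q : k[X], B (x₀ + cyc s N y₁ (a, b))
      (aeval s q (N (x₀ + cyc s N y₁ (a, b)))) = 0 := by
    intro q
    rw [H.form_N_add_cyc, hv, hw, hg₁, hh₁, add_zero, ← coeff_add, ← coeff_add]
    refine (coeff_eq_of_X_pow_dvd_sub ?_).trans (coeff_zero m)
    exact ⟨X * q * r, by linear_combination X * q * hr⟩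
  have hpair : B (x₀ + cyc s N y₁ (a, b)) ((s ^ m) y₁) ≠ 0 := by
    have h1 := hg₁ (X ^ m)
    rw [map_pow, aeval_X, coeff_X_pow_self] at h1
    have h2 : B (cyc s N y₁ (a, b)) ((s ^ m) y₁) = 0 := by
      rw [H.neg, H.adj_pow, ← aeval_X (R := k) s, ← map_pow, aeval_X, aeval_cyc, form_cyc_right,
        H.self_aeval, mul_comm]
      simp [hN]
    rw [map_add, LinearMap.add_apply, h1, h2]
    simp
  generalize x₀ + cyc s N y₁ (a, b) = x₁ at hiso hpair
  obtain ⟨y₂, hg₂, hh₂⟩ := H.exists_dual_odd hs hN x₁ y₁ hpair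
  obtain ⟨u, hu⟩ := hX y₂
  refine ⟨x₁, y₂ + cyc s N x₁ (u, 0), hiso, fun q => ?_, fun q => ?_, fun q => ?_⟩
  · rw [H.form_N_add_cyc, hiso, hu, H.form_swap x₁, H.form_swap_N x₁, hg₂, hg₂, hh₂, zero_sub,
      add_zero, ← coeff_neg, ← coeff_neg, ← coeff_add, ← coeff_add]
    convert coeff_zero m using 2
    ring
  · rw [(H.form_add_cyc_of_isotropic hiso _ _ _ _).1, hg₂]
  · rw [(H.form_add_cyc_of_isotropic hiso _ _ _ _).2, hh₂]

end SpPair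
end NormalForms

section Splitting

open Polynomial Module

variable {k V V' M : Type*} [Field k] [AddCommGroup V] [Module k V] [AddCommGroup V'] [Module k V']
  [AddCommGroup M] [Module k M]

/-- Isomorphism of symplectic spaces with a pair of operators. -/
def SpIso (B : V →ₗ[k] V →ₗ[k] k) (s N : End k V) (B' : V' →ₗ[k] V' →ₗ[k] k)
    (s' N' : End k V') : Prop :=
  ∃ e : V ≃ₗ[k] V', (∀ x, e (s x) = s' (e x)) ∧ (∀ x, e (N x) = N' (e x)) ∧
    ∀ x y, B' (e x) (e y) = B x y

/-- The form `B(x, s^i N y)` is not alternating on the kernel of `s^(i+1)`. -/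
def Eps (B : V →ₗ[k] V →ₗ[k] k) (s N : End k V) (i : ℕ) : Prop :=
  ∃ x, (s ^ (i + 1)) x = 0 ∧ B x ((s ^ i) (N x)) ≠ 0

/-- Equality of the numerical invariants of two symplectic pairs. -/
structure SameType (B : V →ₗ[k] V →ₗ[k] k) (s N : End k V) (B' : V' →ₗ[k] V' →ₗ[k] k)
    (s' N' : End k V') : Prop where
  even : ∀ i, finrank k (LinearMap.ker (s ^ i)) = finrank k (LinearMap.ker (s' ^ i))
  odd : ∀ i, finrank k (LinearMap.ker (s ^ i * N)) = finrank k (LinearMap.ker (s' ^ i * N'))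
  eps : ∀ i, Eps B s N i ↔ Eps B' s' N' i

lemma finrank_ker_of_isCompl [FiniteDimensional k V] {X Y : Submodule k V} (h : IsCompl X Y)
    (T : End k V) (TX : End k X) (TY : End k Y) (hX : ∀ x, (TX x : V) = T x)
    (hY : ∀ y, (TY y : V) = T y) :
    finrank k (LinearMap.ker T) = finrank k (LinearMap.ker TX) + finrank k (LinearMap.ker TY) := by
  let e := Submodule.prodEquivOfIsCompl X Y h
  have h1 : (LinearMap.ker (TX.prodMap TY)).map (e : X × Y →ₗ[k] V) = LinearMap.ker T := by
    have key : ∀ p, T (e p) = e (TX.prodMap TY p) := fun p => by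
      simp [e, Submodule.coe_prodEquivOfIsCompl', hX, hY]
    ext v
    constructor
    · rintro ⟨p, hp, rfl⟩
      rw [SetLike.mem_coe, LinearMap.mem_ker] at hp
      rw [LinearMap.mem_ker]
      exact (key p).trans (by rw [hp, map_zero])
    · intro hv
      refine ⟨e.symm v, ?_, by simp⟩
      rw [SetLike.mem_coe, LinearMap.mem_ker]
      apply e.injective
      rw [← key, e.apply_symm_apply, map_zero]
      exact hv
  let r : ((LinearMap.ker TX).prod (LinearMap.ker TY) : Submodule k (X × Y)) ≃ₗ[k]
      LinearMap.ker TX × LinearMap.ker TY :=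
    { toFun := fun p => (⟨p.1.1, p.2.1⟩, ⟨p.1.2, p.2.2⟩)
      map_add' := fun _ _ => rfl
      map_smul' := fun _ _ => rfl
      invFun := fun p => ⟨(p.1, p.2), p.1.2, p.2.2⟩
      left_inv := fun _ => rfl
      right_inv := fun _ => rfl }
  rw [← h1, LinearEquiv.finrank_map_eq, LinearMap.ker_prodMap, r.finrank_eq, Module.finrank_prod]

variable {B' : V' →ₗ[k] V' →ₗ[k] k} {s' N' : End k V'} {B : V →ₗ[k] V →ₗ[k] k} {s N : End k V}

/-- The orthogonal complement of the image of `f`. -/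
abbrev perp (B : V →ₗ[k] V →ₗ[k] k) (f : M →ₗ[k] V) : Submodule k V :=
  LinearMap.BilinForm.orthogonal B (LinearMap.range f)

lemma mem_perp {f : M →ₗ[k] V} {y : V} : y ∈ perp B f ↔ ∀ m, B (f m) y = 0 := by
  simp [perp, LinearMap.BilinForm.mem_orthogonal_iff]

/-- `f` identifies a quotient of `M`, with operators induced by `σ` and `ν`, with a nondegenerate
subspace stable under `s` and `N`. -/
structure IsBlock (B : V →ₗ[k] V →ₗ[k] k) (s N : End k V) (f : M →ₗ[k] V) (σ ν : M → M) :
    Prop where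
  map_s : ∀ m, s (f m) = f (σ m)
  map_N : ∀ m, N (f m) = f (ν m)
  nondeg : ∀ m, (∀ m', B (f m) (f m') = 0) → f m = 0

namespace IsBlock

variable {f : M →ₗ[k] V} {f' : M →ₗ[k] V'} {σ ν : M → M}

lemma isCompl [FiniteDimensional k V] (H : SpPair B s N) (F : IsBlock B s N f σ ν) :
    IsCompl (LinearMap.range f) (perp B f) := by
  have hrefl : LinearMap.BilinForm.IsRefl B := fun x y h => by rw [H.neg, h, neg_zero]
  rw [LinearMap.BilinForm.isCompl_orthogonal_iff_disjoint hrefl, Submodule.disjoint_def]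
  rintro _ ⟨m, rfl⟩ hm
  exact F.nondeg m fun m' => by rw [H.neg, mem_perp.1 hm, neg_zero]

lemma exists_eq_add [FiniteDimensional k V] (H : SpPair B s N) (F : IsBlock B s N f σ ν) (v : V) :
    ∃ m, ∃ y : perp B f, v = f m + y := by
  have : v ∈ LinearMap.range f ⊔ perp B f := by rw [(F.isCompl H).sup_eq_top]; trivial
  obtain ⟨_, ⟨m, rfl⟩, y, hy, rfl⟩ := Submodule.mem_sup.1 this
  exact ⟨m, ⟨y, hy⟩, rfl⟩

lemma form_left (y : perp B f) (m : M) : B (f m) y = 0 := mem_perp.1 y.2 m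

lemma form_right (H : SpPair B s N) (y : perp B f) (m : M) : B y (f m) = 0 := by
  rw [H.neg, form_left, neg_zero]

lemma s_mem (H : SpPair B s N) (F : IsBlock B s N f σ ν) : ∀ y ∈ perp B f, s y ∈ perp B f := by
  intro y hy
  rw [mem_perp] at hy ⊢
  intro m
  rw [← H.adj_s, F.map_s, hy]

lemma N_mem (H : SpPair B s N) (F : IsBlock B s N f σ ν) : ∀ y ∈ perp B f, N y ∈ perp B f := by
  intro y hy
  have h := F.s_mem H y hy
  rw [mem_perp] at hy h ⊢
  intro m
  have := H.adj_N (f m) y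
  rw [F.map_N, hy, h] at this
  linear_combination this

variable (H : SpPair B s N) (F : IsBlock B s N f σ ν)
variable (H' : SpPair B' s' N') (F' : IsBlock B' s' N' f' σ ν)

include F in
lemma map_s_pow (i : ℕ) (m : M) : (s ^ i) (f m) = f (σ^[i] m) := by
  induction i with
  | zero => simp
  | succ i ih => rw [pow_succ', Module.End.mul_apply, ih, F.map_s, Function.iterate_succ_apply']

/-- The form on the complement of a block. -/
abbrev formY (B : V →ₗ[k] V →ₗ[k] k) (f : M →ₗ[k] V) : perp B f →ₗ[k] perp B f →ₗ[k] k :=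
  LinearMap.domRestrict₁₂ B (perp B f) (perp B f)

/-- The operator `s` on the complement of a block. -/
abbrev sY : End k (perp B f) := s.restrict (F.s_mem H)

/-- The operator `N` on the complement of a block. -/
abbrev NY : End k (perp B f) := N.restrict (F.N_mem H)

lemma coe_sY_pow (i : ℕ) (y : perp B f) : (((F.sY H) ^ i) y : V) = (s ^ i) y := by
  induction i generalizing y with
  | zero => simp
  | succ i ih => rw [pow_succ, pow_succ, Module.End.mul_apply, ih]; rfl

lemma spPair [FiniteDimensional k V] : SpPair (formY B f) (F.sY H) (F.NY H) where
  alt x := H.alt x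
  nondeg x hx := by
    apply Subtype.ext
    apply H.nondeg
    intro v
    obtain ⟨m, y, rfl⟩ := F.exists_eq_add H v
    rw [map_add, form_right H, zero_add]
    exact hx y
  nil := by
    obtain ⟨i, hi⟩ := H.nil
    refine ⟨i, LinearMap.ext fun y => Subtype.ext ?_⟩
    rw [coe_sY_pow, hi]
    rfl
  comm x := Subtype.ext (H.comm x)
  sq x := Subtype.ext (H.sq x)
  adj_s x y := H.adj_s x y
  adj_N x y := H.adj_N x y

lemma eps_of_eps_perp (i : ℕ) (h : Eps (formY B f) (F.sY H) (F.NY H) i) : Eps B s N i := by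
  obtain ⟨y, hy, hne⟩ := h
  refine ⟨y, ?_, ?_⟩
  · rw [← coe_sY_pow H F, hy]; rfl
  · intro h0
    apply hne
    change B y ((((F.sY H) ^ i) ((F.NY H) y) : perp B f) : V) = 0
    rw [coe_sY_pow]
    exact h0

/-- The form `B(v, s^i N v)` is additive along the decomposition. -/
lemma top_add (i : ℕ) (m : M) (y : perp B f) :
    B (f m + y) ((s ^ i) (N (f m + y))) =
      B (f m) ((s ^ i) (N (f m))) + formY B f y (((F.sY H) ^ i) (F.NY H y)) := by
  change _ = _ + B y ((((F.sY H) ^ i) (F.NY H y) : perp B f) : V)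
  have h1 : B (f m) ((((F.sY H) ^ i) (F.NY H y) : perp B f) : V) = 0 := form_left _ _
  have h2 : B y ((s ^ i) (N (f m))) = 0 := by
    rw [F.map_N, F.map_s_pow, form_right H]
  rw [coe_sY_pow] at h1 ⊢
  change B (f m) ((s ^ i) (N y)) = 0 at h1
  simp only [map_add, LinearMap.add_apply, h1, h2]
  change _ = _ + B y ((s ^ i) (N y))
  ring

lemma eps_perp_of_eps [FiniteDimensional k V] (i : ℕ)
    (hX : ∀ m, (s ^ (i + 1)) (f m) = 0 → B (f m) ((s ^ i) (N (f m))) = 0) (h : Eps B s N i) :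
    Eps (formY B f) (F.sY H) (F.NY H) i := by
  obtain ⟨v, hv, hne⟩ := h
  obtain ⟨m, y, rfl⟩ := F.exists_eq_add H v
  have hd := Submodule.disjoint_def.1 (F.isCompl H).disjoint ((s ^ (i + 1)) (f m))
    ⟨_, (F.map_s_pow _ _).symm⟩ (by
      rw [map_add] at hv
      rw [eq_neg_of_add_eq_zero_left hv, ← coe_sY_pow H F]
      exact neg_mem (Subtype.coe_prop _))
  refine ⟨y, Subtype.ext ?_, ?_⟩
  · rw [map_add, hd, zero_add] at hv
    rw [coe_sY_pow, hv]; rfl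
  · rw [F.top_add H, hX m hd, zero_add] at hne
    exact hne

include F F' in
lemma exists_rangeEquiv (hf : ∀ a b, B (f a) (f b) = B' (f' a) (f' b)) :
    ∃ r : LinearMap.range f ≃ₗ[k] LinearMap.range f',
      ∀ m, (r ⟨f m, m, rfl⟩ : V') = f' m := by
  have hker : LinearMap.ker f = LinearMap.ker f' := by
    ext m
    rw [LinearMap.mem_ker, LinearMap.mem_ker]
    exact ⟨fun h => F'.nondeg m fun m' => by simp [← hf, h],
      fun h => F.nondeg m fun m' => by simp [hf, h]⟩
  refine ⟨f.quotKerEquivRange.symm ≪≫ₗ Submodule.quotEquivOfEq _ _ hker ≪≫ₗ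
    f'.quotKerEquivRange, fun m => ?_⟩
  have : f.quotKerEquivRange.symm ⟨f m, m, rfl⟩ = Submodule.Quotient.mk m := by
    rw [LinearEquiv.symm_apply_eq]; rfl
  simp [this]

include H H' F F' in
lemma finrank_ker_perp_eq [FiniteDimensional k V] [FiniteDimensional k V']
    (hf : ∀ a b, B (f a) (f b) = B' (f' a) (f' b))
    {T : End k V} {T' : End k V'} {τ : M → M}
    (hT : ∀ m, T (f m) = f (τ m)) (hT' : ∀ m, T' (f' m) = f' (τ m))
    {TY : End k (perp B f)} {TY' : End k (perp B' f')}
    (hTY : ∀ y, (TY y : V) = T y) (hTY' : ∀ y, (TY' y : V') = T' y)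
    (h : finrank k (LinearMap.ker T) = finrank k (LinearMap.ker T')) :
    finrank k (LinearMap.ker TY) = finrank k (LinearMap.ker TY') := by
  obtain ⟨r, hr⟩ := exists_rangeEquiv F F' hf
  let TX : End k (LinearMap.range f) := T.restrict (by rintro _ ⟨m, rfl⟩; exact ⟨_, (hT m).symm⟩)
  let TX' : End k (LinearMap.range f') :=
    T'.restrict (by rintro _ ⟨m, rfl⟩; exact ⟨_, (hT' m).symm⟩)
  have h1 := finrank_ker_of_isCompl (F.isCompl H) T TX TY (fun _ => rfl) hTY
  have h2 := finrank_ker_of_isCompl (F'.isCompl H') T' TX' TY' (fun _ => rfl) hTY'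
  have key : ∀ x, r (TX x) = TX' (r x) := by
    rintro ⟨_, m, rfl⟩
    have e1 : TX ⟨f m, m, rfl⟩ = ⟨f (τ m), _, rfl⟩ := Subtype.ext (hT m)
    have e2 : r ⟨f m, m, rfl⟩ = ⟨f' m, m, rfl⟩ := Subtype.ext (hr m)
    rw [e1, e2]
    exact Subtype.ext ((hr _).trans (hT' m).symm)
  have h3 : (LinearMap.ker TX).map (r : _ →ₗ[k] _) = LinearMap.ker TX' := by
    ext v
    constructor
    · rintro ⟨p, hp, rfl⟩
      rw [SetLike.mem_coe, LinearMap.mem_ker] at hp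
      rw [LinearMap.mem_ker]
      exact (key p).symm.trans (by rw [hp, map_zero])
    · intro hv
      refine ⟨r.symm v, ?_, by simp⟩
      rw [SetLike.mem_coe, LinearMap.mem_ker]
      apply r.injective
      rw [key, r.apply_symm_apply, map_zero]
      exact hv
  have h4 : finrank k (LinearMap.ker TX) = finrank k (LinearMap.ker TX') := by
    rw [← h3, LinearEquiv.finrank_map_eq]
  omega

include H H' F F' in
lemma spIso_of_perp [FiniteDimensional k V] [FiniteDimensional k V']
    (hf : ∀ a b, B (f a) (f b) = B' (f' a) (f' b))
    (hY : SpIso (formY B f) (F.sY H) (F.NY H) (formY B' f') (F'.sY H') (F'.NY H')) :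
    SpIso B s N B' s' N' := by
  obtain ⟨r, hr⟩ := exists_rangeEquiv F F' hf
  obtain ⟨eY, hs, hN, hB⟩ := hY
  let e : V ≃ₗ[k] V' := (Submodule.prodEquivOfIsCompl _ _ (F.isCompl H)).symm ≪≫ₗ
    (r.prodCongr eY) ≪≫ₗ Submodule.prodEquivOfIsCompl _ _ (F'.isCompl H')
  have he : ∀ m (y : perp B f), e (f m + y) = f' m + eY y := by
    intro m y
    have : (Submodule.prodEquivOfIsCompl _ _ (F.isCompl H)).symm (f m + y) =
        (⟨f m, m, rfl⟩, y) := by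
      rw [LinearEquiv.symm_apply_eq, Submodule.coe_prodEquivOfIsCompl']
    simp only [e, LinearEquiv.trans_apply, this, LinearEquiv.prodCongr_apply,
      Submodule.coe_prodEquivOfIsCompl', hr]
  refine ⟨e, fun v => ?_, fun v => ?_, fun v w => ?_⟩
  · obtain ⟨m, y, rfl⟩ := F.exists_eq_add H v
    have h1 : s (f m + y) = f (σ m) + (F.sY H y : perp B f) := by rw [map_add, F.map_s]; rfl
    rw [h1, he, he, map_add, F'.map_s, hs]
    rfl
  · obtain ⟨m, y, rfl⟩ := F.exists_eq_add H v
    have h1 : N (f m + y) = f (ν m) + (F.NY H y : perp B f) := by rw [map_add, F.map_N]; rfl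
    rw [h1, he, he, map_add, F'.map_N, hN]
    rfl
  · obtain ⟨m, y, rfl⟩ := F.exists_eq_add H v
    obtain ⟨n, z, rfl⟩ := F.exists_eq_add H w
    have : B' (eY y) (eY z) = B y z := hB y z
    rw [he, he]
    simp only [map_add, LinearMap.add_apply, form_left, form_right H, form_right H', hf, this]

include H H' F F' in
lemma sameType_perp [FiniteDimensional k V] [FiniteDimensional k V']
    (hf : ∀ a b, B (f a) (f b) = B' (f' a) (f' b)) (h : SameType B s N B' s' N')
    (heps : (∀ i, finrank k (LinearMap.ker ((F.sY H) ^ i * F.NY H)) =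
        finrank k (LinearMap.ker ((F'.sY H') ^ i * F'.NY H'))) →
      ∀ i, Eps (formY B f) (F.sY H) (F.NY H) i ↔ Eps (formY B' f') (F'.sY H') (F'.NY H') i) :
    SameType (formY B f) (F.sY H) (F.NY H) (formY B' f') (F'.sY H') (F'.NY H') := by
  have hodd : ∀ i, finrank k (LinearMap.ker ((F.sY H) ^ i * F.NY H)) =
        finrank k (LinearMap.ker ((F'.sY H') ^ i * F'.NY H')) := fun i => by
    refine finrank_ker_perp_eq H F H' F' hf (τ := fun m => σ^[i] (ν m)) (fun m => ?_)
      (fun m => ?_) (fun y => ?_) (fun y => ?_) (h.odd i)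
    · rw [Module.End.mul_apply, F.map_N, F.map_s_pow]
    · rw [Module.End.mul_apply, F'.map_N, F'.map_s_pow]
    · rw [Module.End.mul_apply, coe_sY_pow]; rfl
    · rw [Module.End.mul_apply, coe_sY_pow]; rfl
  exact ⟨fun i => finrank_ker_perp_eq H F H' F' hf (F.map_s_pow i) (F'.map_s_pow i)
    (coe_sY_pow H F i) (coe_sY_pow H' F' i) (h.even i), hodd, heps hodd⟩

end IsBlock
end Splitting

section Blocks

open Polynomial Module

variable {k V : Type*} [Field k] [AddCommGroup V] [Module k V]
variable {B : V →ₗ[k] V →ₗ[k] k} {s N : End k V}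

/-- A nonalternating symmetric form has an anisotropic vector whose orthogonal complement is again
nonalternating, unless the form vanishes on it. -/
lemma exists_anisotropic_of_symm (β : V →ₗ[k] V →ₗ[k] k) (hβ : ∀ x y, β x y = β y x)
    (h : ∃ x, β x x ≠ 0) :
    ∃ x, β x x ≠ 0 ∧ ∀ y, β x y = 0 → (∃ z, β z y ≠ 0) → ∃ w, β x w = 0 ∧ β w w ≠ 0 := by
  obtain ⟨x, hx⟩ := h
  by_cases hw : ∃ w, β x w = 0 ∧ β w w ≠ 0
  · exact ⟨x, hx, fun _ _ _ => hw⟩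
  push Not at hw
  by_cases hy : ∃ y, β x y = 0 ∧ ∃ z, β z y ≠ 0
  swap
  · exact ⟨x, hx, fun y h1 h2 => (hy ⟨y, h1, h2⟩).elim⟩
  obtain ⟨y, hxy, z₀, hz₀⟩ := hy
  obtain ⟨z, hxz, hzy⟩ : ∃ z, β x z = 0 ∧ β y z ≠ 0 := by
    refine ⟨z₀ - (β x z₀ / β x x) • x, ?_, ?_⟩
    · simp [hx]
    · simpa [hβ y x, hxy, hβ y z₀] using hz₀
  refine ⟨x + y, ?_, fun _ _ _ => ⟨z - (β y z / β x x) • x, ?_, ?_⟩⟩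
  · simpa [hβ y x, hxy, hw y hxy] using hx
  · simp [hβ y x, hxy, hxz, hx]
  · simp [hβ z x, hxz, hw z hxz, hzy, hx]

/-- The operation of `s` on the coordinates of a cyclic submodule. -/
noncomputable def cycS (p : k[X] × k[X]) : k[X] × k[X] := (X * p.1, X * p.2)

/-- The operation of `N` on the coordinates of a cyclic submodule. -/
noncomputable def cycN (p : k[X] × k[X]) : k[X] × k[X] := (X * p.2, p.1 + X * p.2)

/-- The sum of the cyclic submodules generated by `x` and `y`. -/
noncomputable abbrev cyc₂ (s N : End k V) (x y : V) :
    ((k[X] × k[X]) × (k[X] × k[X])) →ₗ[k] V :=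
  (cyc s N x).coprod (cyc s N y)

lemma cyc_eq_zero_of_dvd {m : ℕ} (hs : s ^ (m + 1) = 0) (x : V) {a b : k[X]}
    (ha : X ^ (m + 1) ∣ a) (hb : X ^ (m + 1) ∣ b) : cyc s N x (a, b) = 0 := by
  rw [cyc_apply, aeval_eq_zero_of_X_pow_dvd hs ha, aeval_eq_zero_of_X_pow_dvd hs hb]
  simp

lemma cyc_eq_zero_of_dvd_odd {m : ℕ} (hs : s ^ (m + 1) = 0) (hN : ∀ x, (s ^ m) (N x) = 0) (x : V)
    {a b : k[X]} (ha : X ^ (m + 1) ∣ a) (hb : X ^ m ∣ b) : cyc s N x (a, b) = 0 := by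
  rw [cyc_apply, aeval_eq_zero_of_X_pow_dvd hs ha]
  obtain ⟨q, rfl⟩ := hb
  rw [mul_comm]
  simp [hN]

lemma X_pow_dvd_of_mul {i j : ℕ} {a : k[X]} (h : X ^ (i + j) ∣ X ^ i * a) : X ^ j ∣ a := by
  rw [pow_add] at h
  exact (mul_dvd_mul_iff_left (pow_ne_zero _ X_ne_zero)).1 h

namespace SpPair

variable (H : SpPair B s N)
include H

lemma top_eq_zero_even {m i j : ℕ} (hs : s ^ (m + 1) = 0) (hij : i + j + 1 = m) (v : V) :
    B ((s ^ (j + 1)) v) ((s ^ i) (N ((s ^ (j + 1)) v))) = 0 := by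
  rw [H.adj_pow, H.comm_pow, ← End.mul_apply, ← End.mul_apply, ← pow_add, ← pow_add,
    show j + 1 + i + (j + 1) = m + 1 + j by omega, pow_add, hs]
  simp

lemma top_eq_zero_odd {m i j : ℕ} (hs : s ^ (m + 1) = 0) (hN : ∀ x, (s ^ m) (N x) = 0)
    (hij : i + j + 1 = m) (v w : V) :
    B ((s ^ (j + 1)) v + (s ^ j) (N w)) ((s ^ i) (N ((s ^ (j + 1)) v + (s ^ j) (N w)))) = 0 := by
  have h1 : (s ^ i) (N ((s ^ (j + 1)) v + (s ^ j) (N w))) = (s ^ m) w := by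
    rw [map_add, H.comm_pow, H.comm_pow, H.sq, map_add, ← End.mul_apply, ← pow_add,
      show i + (j + 1) = m by omega, hN, zero_add, map_add, map_add, ← End.mul_apply (s ^ i),
      ← End.mul_apply (s ^ i), ← pow_add]
    have e : ∀ u, (s ^ (i + j)) (s u) = (s ^ m) u := fun u => by
      rw [← hij, pow_succ, End.mul_apply]
    rw [e, e, hN, zero_add]
  have h2 : (s ^ (j + 1)) ((s ^ m) w) = 0 := by
    rw [← End.mul_apply, ← pow_add, show j + 1 + m = j + (m + 1) by omega, pow_add, hs]; simp
  have h3 : s ((s ^ j) ((s ^ m) w)) = 0 := by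
    rw [← End.mul_apply, ← pow_succ', h2]
  have h4 : N ((s ^ j) ((s ^ m) w)) = 0 := by
    rw [H.comm_pow, H.comm_pow, hN, map_zero]
  rw [h1, map_add, LinearMap.add_apply, H.adj_pow, h2, H.adj_pow, H.adj_N, h3, h4]
  simp

section Cyclic

variable {m : ℕ} (hs : s ^ (m + 1) = 0) {x : V} (hx : ∀ q : k[X], B x (aeval s q (N x)) = q.coeff m)
include hx

lemma form_cyc_self (p p' : k[X] × k[X]) :
    B (cyc s N x p) (cyc s N x p') = (p.1 * p'.2 - p.2 * p'.1).coeff m := by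
  rw [H.gram x x p.1 p.2 p'.1 p'.2, H.self_aeval, hx, zero_add]

lemma dvd_of_cyc_radical {p : k[X] × k[X]}
    (h : ∀ p', B (cyc s N x p) (cyc s N x p') = 0) : X ^ (m + 1) ∣ p.1 ∧ X ^ (m + 1) ∣ p.2 := by
  simp only [H.form_cyc_self hx] at h
  constructor
  · exact X_pow_dvd_of_coeff_mul_eq_zero _ _ fun q => by simpa using h (0, q)
  · exact X_pow_dvd_of_coeff_mul_eq_zero _ _ fun q => by simpa using h (q, 0)

include hs

lemma isBlock_cyc : IsBlock B s N (cyc s N x) cycS cycN where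
  map_s := s_cyc s N x
  map_N := H.N_cyc x
  nondeg p h := by
    obtain ⟨h1, h2⟩ := H.dvd_of_cyc_radical hx h
    exact cyc_eq_zero_of_dvd hs x h1 h2

lemma top_cyc_eq_zero {i j : ℕ} (hij : i + j + 1 = m) (p : k[X] × k[X])
    (hp : (s ^ (i + 1)) (cyc s N x p) = 0) :
    B (cyc s N x p) ((s ^ i) (N (cyc s N x p))) = 0 := by
  obtain ⟨a, b⟩ := p
  have e := aeval_cyc s N (X ^ (i + 1)) x a b
  rw [map_pow, aeval_X, hp] at e
  obtain ⟨h1, h2⟩ := H.dvd_of_cyc_radical hx (p := (X ^ (i + 1) * a, X ^ (i + 1) * b))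
    fun p' => by rw [← e]; simp
  rw [show m + 1 = i + 1 + (j + 1) by omega] at h1 h2
  obtain ⟨a, rfl⟩ := X_pow_dvd_of_mul h1
  obtain ⟨b, rfl⟩ := X_pow_dvd_of_mul h2
  have e' := aeval_cyc s N (X ^ (j + 1)) x a b
  rw [map_pow, aeval_X] at e'
  rw [← e', H.top_eq_zero_even hs hij]

lemma eps_perp_cyc_iff [FiniteDimensional k V]
    (hgood : ∀ y, B x ((s ^ m) (N y)) = 0 → (s ^ m) (N y) ≠ 0 →
      ∃ w, B x ((s ^ m) (N w)) = 0 ∧ B w ((s ^ m) (N w)) ≠ 0) :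
    Eps (IsBlock.formY B (cyc s N x)) ((H.isBlock_cyc hs hx).sY H) ((H.isBlock_cyc hs hx).NY H) m ↔
      ∃ y, ((H.isBlock_cyc hs hx).sY H ^ m * (H.isBlock_cyc hs hx).NY H) y ≠ 0 := by
  set F := H.isBlock_cyc hs hx
  have hx1 : cyc s N x (1, 0) = x := by simp [cyc_apply]
  have hcoe : ∀ y, (((F.sY H ^ m) (F.NY H y) : perp B (cyc s N x)) : V) = (s ^ m) (N y) :=
    fun y => F.coe_sY_pow H m _
  have horth : ∀ y : perp B (cyc s N x), B x ((s ^ m) (N y)) = 0 := fun y => by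
    rw [← hcoe]
    simpa [hx1] using IsBlock.form_left ((F.sY H ^ m) (F.NY H y)) (1, 0)
  constructor
  · rintro ⟨y, -, hy⟩
    refine ⟨y, fun h => hy ?_⟩
    rw [End.mul_apply] at h
    rw [h, map_zero]
  · rintro ⟨y, hy⟩
    obtain ⟨w, hw, hww⟩ := hgood y (horth y) fun h => hy (Subtype.ext (by
      rw [End.mul_apply, hcoe, h]; rfl))
    obtain ⟨⟨a, b⟩, y', rfl⟩ := F.exists_eq_add H w
    have ha : a.coeff 0 = 0 := by
      rw [map_add, map_add, map_add, horth, add_zero, ← H.top_symm hs, H.top_cyc hs] at hw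
      have := hx (X ^ m)
      simp only [map_pow, aeval_X, coeff_X_pow_self] at this
      simpa [this] using hw
    refine ⟨y', Subtype.ext ?_, ?_⟩
    · rw [F.coe_sY_pow H, hs]; rfl
    · rw [F.top_add H, H.top_cyc hs, ha, zero_mul, zero_add] at hww
      exact hww

end Cyclic

section Hyperbolic

variable {m : ℕ} (hs : s ^ (m + 1) = 0) {x y : V} (hx : ∀ q : k[X], B x (aeval s q (N x)) = 0)
  (hy : ∀ q : k[X], B y (aeval s q (N y)) = 0)

omit H in
lemma map_s_cyc₂ (p : (k[X] × k[X]) × (k[X] × k[X])) :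
    s (cyc₂ s N x y p) = cyc₂ s N x y (Prod.map cycS cycS p) := by
  simp [s_cyc, cycS]

lemma map_N_cyc₂ (p : (k[X] × k[X]) × (k[X] × k[X])) :
    N (cyc₂ s N x y p) = cyc₂ s N x y (Prod.map cycN cycN p) := by
  simp [H.N_cyc, cycN]

omit H in
lemma s_pow_cyc₂ (i : ℕ) (a b c d : k[X]) :
    (s ^ i) (cyc₂ s N x y ((a, b), (c, d))) =
      cyc₂ s N x y ((X ^ i * a, X ^ i * b), (X ^ i * c, X ^ i * d)) := by
  have e := aeval_cyc s N (X ^ i) x a b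
  have e' := aeval_cyc s N (X ^ i) y c d
  rw [map_pow, aeval_X] at e e'
  simp [e, e']

include hx hy in
lemma form_cyc₂ (p p' : (k[X] × k[X]) × (k[X] × k[X])) :
    B (cyc₂ s N x y p) (cyc₂ s N x y p') =
      B (cyc s N x p.1) (cyc s N y p'.2) - B (cyc s N x p'.1) (cyc s N y p.2) := by
  have h1 : B (cyc s N x p.1) (cyc s N x p'.1) = 0 := by
    rw [H.gram x x p.1.1 p.1.2 p'.1.1 p'.1.2, H.self_aeval, hx, zero_add]
  have h2 : B (cyc s N y p.2) (cyc s N y p'.2) = 0 := by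
    rw [H.gram y y p.2.1 p.2.2 p'.2.1 p'.2.2, H.self_aeval, hy, zero_add]
  simp only [LinearMap.coprod_apply, map_add, LinearMap.add_apply, h1, h2,
    H.neg (cyc s N y p.2) (cyc s N x p'.1)]
  ring

section Even

variable (hg : ∀ q : k[X], B x (aeval s q y) = 0)
  (hh : ∀ q : k[X], B x (aeval s q (N y)) = q.coeff m)
include hx hy hg hh

lemma form_cyc₂_even (p p' : (k[X] × k[X]) × (k[X] × k[X])) :
    B (cyc₂ s N x y p) (cyc₂ s N x y p') =
      (p.1.1 * p'.2.2 - p.1.2 * p'.2.1).coeff m - (p'.1.1 * p.2.2 - p'.1.2 * p.2.1).coeff m := by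
  rw [H.form_cyc₂ hx hy, H.gram x y p.1.1 p.1.2 p'.2.1 p'.2.2,
    H.gram x y p'.1.1 p'.1.2 p.2.1 p.2.2, hg, hg, hh, hh, zero_add, zero_add]

lemma dvd_of_radical_even {a b c d : k[X]}
    (h : ∀ p', B (cyc₂ s N x y ((a, b), (c, d))) (cyc₂ s N x y p') = 0) :
    (X ^ (m + 1) ∣ a ∧ X ^ (m + 1) ∣ b) ∧ X ^ (m + 1) ∣ c ∧ X ^ (m + 1) ∣ d := by
  simp only [H.form_cyc₂_even hx hy hg hh] at h
  refine ⟨⟨?_, ?_⟩, ?_, ?_⟩ <;> refine X_pow_dvd_of_coeff_mul_eq_zero _ _ fun q => ?_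
  · simpa using h (0, (0, q))
  · simpa using h (0, (q, 0))
  · simpa [mul_comm c q] using h ((0, q), 0)
  · simpa [mul_comm d q] using h ((q, 0), 0)

include hs

lemma isBlock_even : IsBlock B s N (cyc₂ s N x y) (Prod.map cycS cycS) (Prod.map cycN cycN) where
  map_s := map_s_cyc₂
  map_N := H.map_N_cyc₂
  nondeg := by
    rintro ⟨⟨a, b⟩, c, d⟩ h
    obtain ⟨⟨h1, h2⟩, h3, h4⟩ := H.dvd_of_radical_even hx hy hg hh h
    rw [LinearMap.coprod_apply, cyc_eq_zero_of_dvd hs x h1 h2, cyc_eq_zero_of_dvd hs y h3 h4,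
      add_zero]

lemma top_even_eq_zero {i j : ℕ} (hij : i + j + 1 = m) (p : (k[X] × k[X]) × (k[X] × k[X]))
    (hp : (s ^ (i + 1)) (cyc₂ s N x y p) = 0) :
    B (cyc₂ s N x y p) ((s ^ i) (N (cyc₂ s N x y p))) = 0 := by
  obtain ⟨⟨a, b⟩, c, d⟩ := p
  rw [s_pow_cyc₂] at hp
  obtain ⟨⟨h1, h2⟩, h3, h4⟩ := H.dvd_of_radical_even hx hy hg hh fun p' => by
    rw [hp, map_zero, LinearMap.zero_apply]
  rw [show m + 1 = i + 1 + (j + 1) by omega] at h1 h2 h3 h4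
  obtain ⟨a, rfl⟩ := X_pow_dvd_of_mul h1
  obtain ⟨b, rfl⟩ := X_pow_dvd_of_mul h2
  obtain ⟨c, rfl⟩ := X_pow_dvd_of_mul h3
  obtain ⟨d, rfl⟩ := X_pow_dvd_of_mul h4
  rw [← s_pow_cyc₂, H.top_eq_zero_even hs hij]

end Even

section Odd

variable (hN : ∀ x, (s ^ m) (N x) = 0) (hg : ∀ q : k[X], B x (aeval s q y) = q.coeff m)
  (hh : ∀ q : k[X], B x (aeval s q (N y)) = 0)
include hx hy hg hh

lemma form_cyc₂_odd (p p' : (k[X] × k[X]) × (k[X] × k[X])) :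
    B (cyc₂ s N x y p) (cyc₂ s N x y p') =
      (p.1.1 * p'.2.1 + X * p.1.2 * p'.2.1 - X * p.1.2 * p'.2.2).coeff m -
        (p'.1.1 * p.2.1 + X * p'.1.2 * p.2.1 - X * p'.1.2 * p.2.2).coeff m := by
  rw [H.form_cyc₂ hx hy, H.gram x y p.1.1 p.1.2 p'.2.1 p'.2.2,
    H.gram x y p'.1.1 p'.1.2 p.2.1 p.2.2, hg, hg, hh, hh, add_zero, add_zero]

lemma dvd_of_radical_odd {a b c d : k[X]}
    (h : ∀ p', B (cyc₂ s N x y ((a, b), (c, d))) (cyc₂ s N x y p') = 0) :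
    (X ^ (m + 1) ∣ a ∧ X ^ m ∣ b) ∧ X ^ (m + 1) ∣ c ∧ X ^ m ∣ d := by
  simp only [H.form_cyc₂_odd hx hy hg hh] at h
  have hX : ∀ {b : k[X]}, X ^ (m + 1) ∣ X * b → X ^ m ∣ b := fun {b} hb => by
    refine X_pow_dvd_of_mul (i := 1) ?_
    rwa [add_comm, pow_one]
  have hb : X ^ (m + 1) ∣ X * b :=
    X_pow_dvd_of_coeff_mul_eq_zero _ _ fun q => by simpa using h (0, (0, q))
  have hab : X ^ (m + 1) ∣ a + X * b :=
    X_pow_dvd_of_coeff_mul_eq_zero _ _ fun q => by simpa [add_mul] using h (0, (q, 0))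
  have hc : X ^ (m + 1) ∣ c :=
    X_pow_dvd_of_coeff_mul_eq_zero _ _ fun q => by simpa [mul_comm c q] using h ((q, 0), 0)
  have hcd : X ^ (m + 1) ∣ X * (c - d) :=
    X_pow_dvd_of_coeff_mul_eq_zero _ _ fun q => by
      rw [show X * (c - d) * q = X * q * c - X * q * d by ring]
      have := h ((0, q), 0)
      simp only [zero_mul, mul_zero, Prod.fst_zero, Prod.snd_zero, zero_add, sub_zero, coeff_zero,
        zero_sub, neg_eq_zero] at this
      exact this
  refine ⟨⟨(dvd_add_left hb).1 hab, hX hb⟩, hc, hX ?_⟩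
  have := dvd_sub (hc.mul_left X) hcd
  rwa [show X * c - X * (c - d) = X * d by ring] at this

include hs hN

lemma isBlock_odd : IsBlock B s N (cyc₂ s N x y) (Prod.map cycS cycS) (Prod.map cycN cycN) where
  map_s := map_s_cyc₂
  map_N := H.map_N_cyc₂
  nondeg := by
    rintro ⟨⟨a, b⟩, c, d⟩ h
    obtain ⟨⟨h1, h2⟩, h3, h4⟩ := H.dvd_of_radical_odd hx hy hg hh h
    rw [LinearMap.coprod_apply, cyc_eq_zero_of_dvd_odd hs hN x h1 h2,
      cyc_eq_zero_of_dvd_odd hs hN y h3 h4, add_zero]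

lemma top_odd_eq_zero {i j : ℕ} (hij : i + j + 1 = m) (p : (k[X] × k[X]) × (k[X] × k[X]))
    (hp : (s ^ (i + 1)) (cyc₂ s N x y p) = 0) :
    B (cyc₂ s N x y p) ((s ^ i) (N (cyc₂ s N x y p))) = 0 := by
  obtain ⟨⟨a, b⟩, c, d⟩ := p
  rw [s_pow_cyc₂] at hp
  obtain ⟨⟨h1, h2⟩, h3, h4⟩ := H.dvd_of_radical_odd hx hy hg hh fun p' => by
    rw [hp, map_zero, LinearMap.zero_apply]
  rw [show m + 1 = i + 1 + (j + 1) by omega] at h1 h3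
  rw [show m = i + 1 + j by omega] at h2 h4
  obtain ⟨a, rfl⟩ := X_pow_dvd_of_mul h1
  obtain ⟨b, rfl⟩ := X_pow_dvd_of_mul h2
  obtain ⟨c, rfl⟩ := X_pow_dvd_of_mul h3
  obtain ⟨d, rfl⟩ := X_pow_dvd_of_mul h4
  have e : cyc₂ s N x y ((X ^ (j + 1) * a, X ^ j * b), (X ^ (j + 1) * c, X ^ j * d)) =
      (s ^ (j + 1)) (aeval s a x + aeval s c y) +
        (s ^ j) (N (aeval s b x + aeval s d y)) := by
    simp only [LinearMap.coprod_apply, cyc_apply, map_mul, map_pow, aeval_X, End.mul_apply,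
      map_add, H.comm_aeval]
    abel
  rw [e, H.top_eq_zero_odd hs hN hij]

end Odd

end Hyperbolic

end SpPair
end Blocks

section Classification

open Polynomial Module

universe u

lemma finrank_ker_eq_finrank_iff {k V : Type*} [Field k] [AddCommGroup V] [Module k V]
    [FiniteDimensional k V] (T : End k V) :
    finrank k (LinearMap.ker T) = finrank k V ↔ T = 0 := by
  rw [← LinearMap.ker_eq_top]
  exact ⟨Submodule.eq_top_of_finrank_eq, fun h => by rw [h, finrank_top]⟩

variable {k : Type*} [Field k]

section SameType

variable {V V' : Type*} [AddCommGroup V] [Module k V] [AddCommGroup V'] [Module k V']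
  [FiniteDimensional k V] [FiniteDimensional k V']
  {B : V →ₗ[k] V →ₗ[k] k} {s N : End k V} {B' : V' →ₗ[k] V' →ₗ[k] k} {s' N' : End k V'}

lemma eq_zero_iff_of_finrank_ker_eq {T : End k V} {T' : End k V'}
    (h : finrank k V = finrank k V')
    (hT : finrank k (LinearMap.ker T) = finrank k (LinearMap.ker T')) : T = 0 ↔ T' = 0 := by
  rw [← finrank_ker_eq_finrank_iff, ← finrank_ker_eq_finrank_iff, h, hT]

lemma SameType.finrank_eq (h : SameType B s N B' s' N') (H : SpPair B s N) (H' : SpPair B' s' N') :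
    finrank k V = finrank k V' := by
  obtain ⟨i, hi⟩ := H.nil
  obtain ⟨j, hj⟩ := H'.nil
  have := h.even (i + j)
  rwa [(finrank_ker_eq_finrank_iff _).2 (by rw [pow_add, hi, zero_mul]),
    (finrank_ker_eq_finrank_iff _).2 (by rw [pow_add, hj, mul_zero])] at this

end SameType

lemma not_eps_of_le {V : Type*} [AddCommGroup V] [Module k V] {B : V →ₗ[k] V →ₗ[k] k}
    {s N : End k V} {m i : ℕ} (hs : s ^ m * N = 0) (hi : m ≤ i) : ¬ Eps B s N i := by
  rintro ⟨x, -, hx⟩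
  obtain ⟨j, rfl⟩ := Nat.exists_eq_add_of_le' hi
  rw [pow_add, End.mul_apply, ← End.mul_apply (s ^ m), hs] at hx
  simp at hx

/-- The classification statement for spaces of dimension less than `n`. -/
def ClassifiedBelow (k : Type*) [Field k] (n : ℕ) : Prop :=
  ∀ (V V' : Type u) [AddCommGroup V] [Module k V] [AddCommGroup V'] [Module k V']
    [FiniteDimensional k V] [FiniteDimensional k V']
    (B : V →ₗ[k] V →ₗ[k] k) (s N : End k V) (B' : V' →ₗ[k] V' →ₗ[k] k) (s' N' : End k V'),
    finrank k V < n → SpPair B s N → SpPair B' s' N' → SameType B s N B' s' N' →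
    SpIso B s N B' s' N'

variable {V V' : Type u} [AddCommGroup V] [Module k V] [AddCommGroup V'] [Module k V']
  [FiniteDimensional k V] [FiniteDimensional k V']
  {B : V →ₗ[k] V →ₗ[k] k} {s N : End k V} {B' : V' →ₗ[k] V' →ₗ[k] k} {s' N' : End k V'}

lemma ClassifiedBelow.spIso_of_block {M : Type*} [AddCommGroup M] [Module k M]
    (IH : ClassifiedBelow.{u} k (finrank k V)) (H : SpPair B s N) (H' : SpPair B' s' N')
    (h : SameType B s N B' s' N') {f : M →ₗ[k] V} {f' : M →ₗ[k] V'} {σ ν : M → M}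
    (F : IsBlock B s N f σ ν) (F' : IsBlock B' s' N' f' σ ν) (hne : f ≠ 0)
    (hf : ∀ a b, B (f a) (f b) = B' (f' a) (f' b))
    (heps : (∀ i, finrank k (LinearMap.ker ((F.sY H) ^ i * F.NY H)) =
        finrank k (LinearMap.ker ((F'.sY H') ^ i * F'.NY H'))) →
      ∀ i, Eps (IsBlock.formY B f) (F.sY H) (F.NY H) i ↔
        Eps (IsBlock.formY B' f') (F'.sY H') (F'.NY H') i) :
    SpIso B s N B' s' N' := by
  refine IsBlock.spIso_of_perp H F H' F' hf (IH _ _ _ _ _ _ _ _ ?_ (F.spPair H) (F'.spPair H')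
    (IsBlock.sameType_perp H F H' F' hf h heps))
  have h1 := Submodule.finrank_add_eq_of_isCompl (F.isCompl H)
  have h2 : 0 < finrank k (LinearMap.range f) := by
    rw [Nat.pos_iff_ne_zero, Ne, Submodule.finrank_eq_zero, LinearMap.range_eq_bot]
    exact hne
  omega

/-- The complements of two blocks have the same `Eps` in degrees where the blocks have none. -/
lemma IsBlock.eps_perp_iff {M : Type*} [AddCommGroup M] [Module k M] (H : SpPair B s N)
    (H' : SpPair B' s' N') {f : M →ₗ[k] V} {f' : M →ₗ[k] V'} {σ ν : M → M}
    (F : IsBlock B s N f σ ν) (F' : IsBlock B' s' N' f' σ ν) {i : ℕ}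
    (hX : ∀ m, (s ^ (i + 1)) (f m) = 0 → B (f m) ((s ^ i) (N (f m))) = 0)
    (hX' : ∀ m, (s' ^ (i + 1)) (f' m) = 0 → B' (f' m) ((s' ^ i) (N' (f' m))) = 0)
    (h : Eps B s N i ↔ Eps B' s' N' i) :
    Eps (IsBlock.formY B f) (F.sY H) (F.NY H) i ↔
      Eps (IsBlock.formY B' f') (F'.sY H') (F'.NY H') i :=
  ⟨fun e => F'.eps_perp_of_eps H' i hX' (h.1 (F.eps_of_eps_perp H i e)),
    fun e => F.eps_perp_of_eps H i hX (h.2 (F'.eps_of_eps_perp H' i e))⟩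

omit [FiniteDimensional k V] in
/-- A generator of a cyclic block such that the form `B(·, s^m N ·)` is not alternating on its
complement, unless zero. -/
lemma SpPair.exists_cyclic_generator [IsAlgClosed k] (H : SpPair B s N) {m : ℕ}
    (hs : s ^ (m + 1) = 0) (he : Eps B s N m) :
    ∃ x, (∀ q : k[X], B x (aeval s q (N x)) = q.coeff m) ∧
      ∀ y, B x ((s ^ m) (N y)) = 0 → (s ^ m) (N y) ≠ 0 →
        ∃ w, B x ((s ^ m) (N w)) = 0 ∧ B w ((s ^ m) (N w)) ≠ 0 := by
  obtain ⟨x₀, -, hx₀⟩ := he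
  obtain ⟨x, hx, hgood⟩ := exists_anisotropic_of_symm (B.compl₂ (s ^ m * N))
    (fun x y => by simpa using H.top_symm hs y x) ⟨x₀, by simpa using hx₀⟩
  obtain ⟨x', hx', c, hc, hcx⟩ := H.exists_cyclic hs x (by simpa using hx)
  refine ⟨x', hx', fun y hy hne => ?_⟩
  simp only [hcx, mul_eq_zero, hc, false_or] at hy ⊢
  refine hgood y (by simpa using hy) ?_
  by_contra hz
  push Not at hz
  exact hne (eq_zero_of_forall_right H fun z => by simpa using hz z)

section Steps

variable [IsAlgClosed k] (IH : ClassifiedBelow.{u} k (finrank k V)) (H : SpPair B s N)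
  (H' : SpPair B' s' N') (h : SameType B s N B' s' N') {m : ℕ} (hs : s ^ (m + 1) = 0)
  (hs' : s' ^ (m + 1) = 0)
include IH H H' h hs hs'

lemma ClassifiedBelow.spIso_cyclic (he : Eps B s N m) : SpIso B s N B' s' N' := by
  obtain ⟨x, hx, hgood⟩ := H.exists_cyclic_generator hs he
  obtain ⟨x', hx', hgood'⟩ := H'.exists_cyclic_generator hs' ((h.eps m).1 he)
  have F := H.isBlock_cyc hs hx
  have F' := H'.isBlock_cyc hs' hx'
  refine IH.spIso_of_block H H' h F F' (fun h0 => ?_)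
    (fun a b => by rw [H.form_cyc_self hx, H'.form_cyc_self hx']) fun hodd i => ?_
  · have := H.form_cyc_self hx (1, 0) (0, X ^ m)
    simp [h0] at this
  have hz : F.sY H ^ (m + 1) = 0 := LinearMap.ext fun y => Subtype.ext (by
    rw [F.coe_sY_pow H, hs]; rfl)
  have hz' : F'.sY H' ^ (m + 1) = 0 := LinearMap.ext fun y => Subtype.ext (by
    rw [F'.coe_sY_pow H', hs']; rfl)
  rcases lt_trichotomy i m with hi | rfl | hi
  · obtain ⟨j, hj⟩ := Nat.exists_eq_add_of_lt hi
    exact IsBlock.eps_perp_iff H H' F F' (H.top_cyc_eq_zero hs hx hj.symm)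
      (H'.top_cyc_eq_zero hs' hx' hj.symm) (h.eps i)
  · rw [H.eps_perp_cyc_iff hs hx hgood, H'.eps_perp_cyc_iff hs' hx' hgood']
    have hfin := hodd (i + 1)
    rw [(finrank_ker_eq_finrank_iff _).2 (by rw [hz, zero_mul]),
      (finrank_ker_eq_finrank_iff _).2 (by rw [hz', zero_mul])] at hfin
    have := eq_zero_iff_of_finrank_ker_eq hfin (hodd i)
    simpa [LinearMap.ext_iff] using not_congr this
  · exact iff_of_false (not_eps_of_le (by rw [hz, zero_mul]) hi)
      (not_eps_of_le (by rw [hz', zero_mul]) hi)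

omit [IsAlgClosed k] in
lemma ClassifiedBelow.spIso_even (hN : s ^ m * N ≠ 0) (hN' : s' ^ m * N' ≠ 0)
    (he : ¬ Eps B s N m) : SpIso B s N B' s' N' := by
  have he' : ¬ Eps B' s' N' m := fun e => he ((h.eps m).2 e)
  have halt : ∀ x, B x ((s ^ m) (N x)) = 0 := fun x => by
    by_contra hx
    exact he ⟨x, by simp [hs], hx⟩
  have halt' : ∀ x, B' x ((s' ^ m) (N' x)) = 0 := fun x => by
    by_contra hx
    exact he' ⟨x, by simp [hs'], hx⟩
  obtain ⟨x, y, hx, hy, hg, hh⟩ := H.exists_hyperbolic_even hs halt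
    (by simpa [LinearMap.ext_iff] using hN)
  obtain ⟨x', y', hx', hy', hg', hh'⟩ := H'.exists_hyperbolic_even hs' halt'
    (by simpa [LinearMap.ext_iff] using hN')
  have F := H.isBlock_even hs hx hy hg hh
  have F' := H'.isBlock_even hs' hx' hy' hg' hh'
  refine IH.spIso_of_block H H' h F F' (fun h0 => ?_)
    (fun a b => by rw [H.form_cyc₂_even hx hy hg hh, H'.form_cyc₂_even hx' hy' hg' hh'])
    fun hodd i => ?_
  · have := H.form_cyc₂_even hx hy hg hh ((1, 0), 0) (0, (0, X ^ m))
    rw [h0] at this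
    simp at this
  rcases lt_trichotomy i m with hi | rfl | hi
  · obtain ⟨j, hj⟩ := Nat.exists_eq_add_of_lt hi
    exact IsBlock.eps_perp_iff H H' F F' (H.top_even_eq_zero hs hx hy hg hh hj.symm)
      (H'.top_even_eq_zero hs' hx' hy' hg' hh' hj.symm) (h.eps i)
  · exact iff_of_false (fun e => he (F.eps_of_eps_perp H _ e))
      (fun e => he' (F'.eps_of_eps_perp H' _ e))
  · exact iff_of_false
      (fun e => not_eps_of_le (by rw [hs, zero_mul]) hi (F.eps_of_eps_perp H _ e))
      (fun e => not_eps_of_le (by rw [hs', zero_mul]) hi (F'.eps_of_eps_perp H' _ e))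

lemma ClassifiedBelow.spIso_odd (hN : s ^ m * N = 0) (hN' : s' ^ m * N' = 0)
    (hm : s ^ m ≠ 0) (hm' : s' ^ m ≠ 0) : SpIso B s N B' s' N' := by
  have hn : ∀ x, (s ^ m) (N x) = 0 := LinearMap.congr_fun hN
  have hn' : ∀ x, (s' ^ m) (N' x) = 0 := LinearMap.congr_fun hN'
  obtain ⟨x, y, hx, hy, hg, hh⟩ := H.exists_hyperbolic_odd hs hn
    (by simpa [LinearMap.ext_iff] using hm)
  obtain ⟨x', y', hx', hy', hg', hh'⟩ := H'.exists_hyperbolic_odd hs' hn'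
    (by simpa [LinearMap.ext_iff] using hm')
  have F := H.isBlock_odd hs hx hy hn hg hh
  have F' := H'.isBlock_odd hs' hx' hy' hn' hg' hh'
  refine IH.spIso_of_block H H' h F F' (fun h0 => ?_)
    (fun a b => by rw [H.form_cyc₂_odd hx hy hg hh, H'.form_cyc₂_odd hx' hy' hg' hh'])
    fun hodd i => ?_
  · have := H.form_cyc₂_odd hx hy hg hh ((1, 0), 0) (0, (X ^ m, 0))
    rw [h0] at this
    simp at this
  rcases lt_or_ge i m with hi | hi
  · obtain ⟨j, hj⟩ := Nat.exists_eq_add_of_lt hi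
    exact IsBlock.eps_perp_iff H H' F F' (H.top_odd_eq_zero hs hx hy hn hg hh hj.symm)
      (H'.top_odd_eq_zero hs' hx' hy' hn' hg' hh' hj.symm) (h.eps i)
  · exact iff_of_false (fun e => not_eps_of_le hN hi (F.eps_of_eps_perp H _ e))
      (fun e => not_eps_of_le hN' hi (F'.eps_of_eps_perp H' _ e))

end Steps

lemma classifiedBelow [IsAlgClosed k] (n : ℕ) : ClassifiedBelow.{u} k n := by
  induction n with
  | zero => intro V V' _ _ _ _ _ _ B s N B' s' N' hlt; omega
  | succ n ih =>
    intro V V' _ _ _ _ _ _ B s N B' s' N' hlt H H' h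
    have IH : ClassifiedBelow.{u} k (finrank k V) := by
      intro W W' _ _ _ _ _ _ C t M C' t' M' hW
      exact ih W W' C t M C' t' M' (by omega)
    have hfin := h.finrank_eq H H'
    have hpow : ∀ i, s ^ i = 0 ↔ s' ^ i = 0 := fun i =>
      eq_zero_iff_of_finrank_ker_eq hfin (h.even i)
    obtain hV | hV := subsingleton_or_nontrivial V
    · have hV' : Subsingleton V' := by
        rw [← finrank_zero_iff (R := k), ← hfin, finrank_zero_iff]
        exact hV
      exact ⟨0, fun x => Subsingleton.elim _ _, fun x => Subsingleton.elim _ _,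
        fun x y => by simp [Subsingleton.elim x 0]⟩
    classical
    obtain ⟨m, hm, hs⟩ : ∃ m, s ^ m ≠ 0 ∧ s ^ (m + 1) = 0 := by
      have hmin := fun j => Nat.find_min H.nil (m := j)
      have hspec := Nat.find_spec H.nil
      rcases hk : Nat.find H.nil with - | m
      · rw [hk, pow_zero] at hspec
        exact (one_ne_zero hspec).elim
      · rw [hk] at hspec
        exact ⟨m, hmin m (by omega), hspec⟩
    have hs' := (hpow _).1 hs
    by_cases he : Eps B s N m
    · exact IH.spIso_cyclic H H' h hs hs' he
    by_cases hN : s ^ m * N = 0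
    · exact IH.spIso_odd H H' h hs hs' hN
        ((eq_zero_iff_of_finrank_ker_eq hfin (h.odd m)).1 hN) hm fun h0 => hm ((hpow m).2 h0)
    · exact IH.spIso_even H H' h hs hs' hN
        (fun h0 => hN ((eq_zero_iff_of_finrank_ker_eq hfin (h.odd m)).2 h0)) he

/-- Symplectic pairs with the same invariants are isomorphic. -/
theorem SameType.spIso [IsAlgClosed k] (H : SpPair B s N) (H' : SpPair B' s' N')
    (h : SameType B s N B' s' N') : SpIso B s N B' s' N' :=
  classifiedBelow (finrank k V + 1) V V' B s N B' s' N' (Nat.lt_succ_self _) H H' h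

end Classification

section Filtration

open Module

variable {k V : Type*} [Field k] [AddCommGroup V] [Module k V]

lemma pow_apply_eq_zero_of_le {N : V →ₗ[k] V} {i j : ℕ} (hij : i ≤ j) {x : V}
    (h : (N ^ i) x = 0) : (N ^ j) x = 0 := by
  obtain ⟨l, rfl⟩ := Nat.exists_eq_add_of_le' hij
  rw [pow_add, End.mul_apply, h, map_zero]

lemma pow_mem_canonFilt {N : V →ₗ[k] V} {a : ℤ} {j n : ℕ} {x : V} (haj : a ≤ j)
    (hn : (n : ℤ) ≤ 2 * j - a + 1) (hx : (N ^ n) x = 0) : (N ^ j) x ∈ canonFilt N a := by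
  refine Submodule.mem_iSup_of_mem (⟨j, haj⟩ : {j : ℕ // a ≤ (j : ℤ)}) ⟨x, ?_, rfl⟩
  exact pow_apply_eq_zero_of_le (by simp only; omega) hx

lemma canonFilt_le {N : V →ₗ[k] V} {a : ℤ} {W : Submodule k V}
    (h : ∀ j n : ℕ, ∀ x : V, a ≤ j → (n : ℤ) = 2 * j - a + 1 → (N ^ n) x = 0 → (N ^ j) x ∈ W) :
    canonFilt N a ≤ W := by
  refine iSup_le fun j => ?_
  rintro _ ⟨x, hx, rfl⟩
  have := j.2
  exact h j _ x this (by omega) hx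

lemma canonFilt_anti (N : V →ₗ[k] V) {a b : ℤ} (hab : a ≤ b) : canonFilt N b ≤ canonFilt N a :=
  canonFilt_le fun j n x hj hn hx => pow_mem_canonFilt (n := n) (by omega) (by omega) hx

lemma map_mem_canonFilt {N : V →ₗ[k] V} {a : ℤ} {x : V} (hx : x ∈ canonFilt N a) :
    N x ∈ canonFilt N (a + 2) := by
  suffices canonFilt N a ≤ (canonFilt N (a + 2)).comap N from this hx
  refine canonFilt_le fun j n x hj hn hx => ?_
  rw [Submodule.mem_comap, ← End.mul_apply, ← pow_succ']
  rcases hj.lt_or_eq with h | h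
  · exact pow_mem_canonFilt (n := n) (by push_cast; omega) (by push_cast; omega) hx
  · rw [pow_apply_eq_zero_of_le (by omega) hx]
    exact zero_mem _

lemma pow_map_mem_canonFilt {N : V →ₗ[k] V} {a b : ℤ} {x : V} (hx : x ∈ canonFilt N a) (n : ℕ)
    (hb : b ≤ a + 2 * n) : (N ^ n) x ∈ canonFilt N b := by
  refine canonFilt_anti N hb ?_
  clear hb
  induction n with
  | zero => simpa using hx
  | succ n ih =>
    rw [pow_succ', End.mul_apply]
    convert map_mem_canonFilt ih using 2
    push_cast
    ring

lemma exists_pow_eq_of_mem_canonFilt {N : V →ₗ[k] V} {a : ℤ} {n : ℕ} (han : 0 ≤ a + n) {x : V}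
    (hx : x ∈ canonFilt N (a + 2 * n)) : ∃ y ∈ canonFilt N a, (N ^ n) y = x := by
  suffices canonFilt N (a + 2 * n) ≤ (canonFilt N a).map (N ^ n) from this hx
  refine canonFilt_le fun j l x hj hl hx => ?_
  obtain ⟨i, rfl⟩ := Nat.exists_eq_add_of_le (show n ≤ j by omega)
  rw [pow_add]
  exact ⟨_, pow_mem_canonFilt (n := l) (by omega) (by omega) hx, rfl⟩

lemma ker_pow_le_canonFilt (N : V →ₗ[k] V) {n : ℕ} {a : ℤ} (ha : a ≤ 0) (han : a ≤ 1 - n) :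
    LinearMap.ker (N ^ n) ≤ canonFilt N a := fun x hx => by
  simpa using pow_mem_canonFilt (N := N) (j := 0) (a := a) (by simpa using ha) (by simp; omega) hx

lemma finrank_ker_pow_add [FiniteDimensional k V] (N : V →ₗ[k] V) (n : ℕ) :
    finrank k (LinearMap.ker (N ^ n)) + finrank k (canonFilt N n) =
      finrank k (canonFilt N (-n)) := by
  have h1 : (canonFilt N (-n)).map (N ^ n) = canonFilt N n := by
    apply le_antisymm
    · rintro _ ⟨x, hx, rfl⟩
      exact pow_map_mem_canonFilt hx n (by omega)
    · intro x hx
      exact exists_pow_eq_of_mem_canonFilt (n := n) (by omega)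
        (by rwa [show -(n : ℤ) + 2 * n = n by ring])
  have h2 := LinearMap.finrank_range_add_finrank_ker ((N ^ n).domRestrict (canonFilt N (-n)))
  rw [LinearMap.range_domRestrict, h1, LinearMap.ker_domRestrict] at h2
  rw [← h2, add_comm]
  congr 1
  exact (Submodule.comapSubtypeEquivOfLe
    (ker_pow_le_canonFilt N (by omega) (by omega))).finrank_eq.symm

lemma map_canonFilt_le {V' : Type*} [AddCommGroup V'] [Module k V'] {N : V →ₗ[k] V}
    {N' : V' →ₗ[k] V'} {e : V →ₗ[k] V'} (he : ∀ x, e (N x) = N' (e x)) (a : ℤ) :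
    (canonFilt N a).map e ≤ canonFilt N' a := by
  have hpow : ∀ n x, e ((N ^ n) x) = (N' ^ n) (e x) := fun n => by
    induction n with
    | zero => simp
    | succ n ih => intro x; rw [pow_succ', pow_succ', End.mul_apply, End.mul_apply, he, ih]
  rw [Submodule.map_le_iff_le_comap]
  refine canonFilt_le fun j n x hj hn hx => ?_
  rw [Submodule.mem_comap, hpow]
  exact pow_mem_canonFilt hj hn.le (by rw [← hpow, hx, map_zero])

lemma pow_sub_pow_mem_canonFilt {N N' : V →ₗ[k] V} (hfilt : ∀ a, canonFilt N a = canonFilt N' a)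
    (hdiff : ∀ a, ∀ x ∈ canonFilt N a, N x - N' x ∈ canonFilt N (a + 3)) {a : ℤ} {x : V}
    (hx : x ∈ canonFilt N a) (n : ℕ) : (N ^ n) x - (N' ^ n) x ∈ canonFilt N (a + 2 * n + 1) := by
  induction n with
  | zero => simp
  | succ n ih =>
    rw [pow_succ', pow_succ', End.mul_apply, End.mul_apply]
    have h1 := map_mem_canonFilt ih
    have h2 := hdiff (a + 2 * n) ((N' ^ n) x) (by
      rw [hfilt] at hx ⊢
      exact pow_map_mem_canonFilt hx n le_rfl)
    have h3 := add_mem (canonFilt_anti N (by push_cast; omega) h1)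
      (canonFilt_anti N (show a + 2 * ((n + 1 : ℕ) : ℤ) + 1 ≤ _ by push_cast; omega) h2)
    rw [map_sub] at h3
    simpa using h3

variable {B : V →ₗ[k] V →ₗ[k] k} (halt : ∀ x : V, B x x = 0)

lemma form_pow_pow_eq_zero {N : V →ₗ[k] V}
    (hsp : ∀ x y : V, B (N x) y + B x (N y) + B (N x) (N y) = 0) {d : ℕ} (u : V) {v : V}
    (hv : (N ^ d) v = 0) (i j : ℕ) (hij : d ≤ i + j) : B ((N ^ i) u) ((N ^ j) v) = 0 := by
  induction i generalizing j with
  | zero => rw [pow_apply_eq_zero_of_le (by omega) hv, map_zero]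
  | succ i ih =>
    obtain ⟨t, ht⟩ : ∃ t, d ≤ j + t := ⟨d, by omega⟩
    induction t generalizing j with
    | zero => rw [pow_apply_eq_zero_of_le (by omega) hv, map_zero]
    | succ t iht =>
      have h := hsp ((N ^ i) u) ((N ^ j) v)
      have e : ∀ l w, N ((N ^ l) w) = (N ^ (l + 1)) w := fun l w => by
        rw [pow_succ', End.mul_apply]
      rw [e, e, ih (j + 1) (by omega), iht (j + 1) (by omega) (by omega)] at h
      simpa using h

include halt

lemma form_canonFilt_eq_zero {N : V →ₗ[k] V}
    (hsp : ∀ x y : V, B (N x) y + B x (N y) + B (N x) (N y) = 0) {a b : ℤ} (hab : 1 ≤ a + b)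
    {x y : V} (hx : x ∈ canonFilt N a) (hy : y ∈ canonFilt N b) : B x y = 0 := by
  have hneg : ∀ x y, B x y = 0 → B y x = 0 := fun x y h => by
    have := halt (x + y)
    simpa [halt, h] using this
  suffices canonFilt N a ≤ LinearMap.ker (B.flip y) from this hx
  refine canonFilt_le fun i n u hi hn hu => ?_
  suffices canonFilt N b ≤ LinearMap.ker (B ((N ^ i) u)) from this hy
  refine canonFilt_le fun j l v hj hl hv => ?_
  rw [LinearMap.mem_ker]
  rcases le_or_gt l (i + j) with h | h
  · exact form_pow_pow_eq_zero hsp u hv i j h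
  · exact hneg _ _ (form_pow_pow_eq_zero hsp v hu j i (by omega))

lemma exists_top_ne_zero_of_canonFilt_eq {N N' : V →ₗ[k] V}
    (hsp : ∀ x y : V, B (N x) y + B x (N y) + B (N x) (N y) = 0)
    (hfilt : ∀ a, canonFilt N a = canonFilt N' a)
    (hdiff : ∀ a, ∀ x ∈ canonFilt N a, N x - N' x ∈ canonFilt N (a + 3)) {n : ℕ}
    (h : ∃ x, (N ^ (n + 1)) x = 0 ∧ B x ((N ^ n) x) ≠ 0) :
    ∃ x, (N' ^ (n + 1)) x = 0 ∧ B x ((N' ^ n) x) ≠ 0 := by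
  obtain ⟨x, hx0, hne⟩ := h
  have hx : x ∈ canonFilt N (-n) := ker_pow_le_canonFilt N (n := n + 1) (by omega)
    (by push_cast; omega) hx0
  have hmem : (N' ^ (n + 1)) x ∈ canonFilt N' (-n + 1 + 2 * ((n + 1 : ℕ) : ℤ)) := by
    have := pow_sub_pow_mem_canonFilt hfilt hdiff hx (n + 1)
    rw [hx0, zero_sub, neg_mem_iff, hfilt] at this
    exact canonFilt_anti N' (by omega) this
  obtain ⟨y, hy, hyx⟩ := exists_pow_eq_of_mem_canonFilt (by push_cast; omega) hmem
  have hy' := hy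
  rw [← hfilt] at hy'
  have hpow : ∀ {a b : ℤ} {z : V}, z ∈ canonFilt N a → b ≤ a + 2 * n →
      (N' ^ n) z ∈ canonFilt N b := fun hz hb => by
    rw [hfilt] at hz ⊢
    exact pow_map_mem_canonFilt hz n hb
  have hxy : x - y ∈ canonFilt N (-n) := sub_mem hx (canonFilt_anti N (by omega) hy')
  refine ⟨x - y, by rw [map_sub, hyx, sub_self], ?_⟩
  have h1 : B x ((N' ^ n) y) = 0 :=
    form_canonFilt_eq_zero halt hsp (b := n + 1) (by omega) hx (hpow hy' (by omega))
  have h2 : B y ((N' ^ n) (x - y)) = 0 :=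
    form_canonFilt_eq_zero halt hsp (b := n) (by omega) hy' (hpow hxy (by omega))
  have h3 : B x ((N ^ n) x - (N' ^ n) x) = 0 :=
    form_canonFilt_eq_zero halt hsp (b := n + 1) (by omega) hx
      (canonFilt_anti N (by omega) (pow_sub_pow_mem_canonFilt hfilt hdiff hx n))
  rw [map_sub, sub_eq_zero] at h3
  rw [map_sub B, LinearMap.sub_apply, h2, sub_zero, map_sub, map_sub, h1, sub_zero, ← h3]
  exact hne

/-- The pair attached to a unipotent isometry `1 + N`, and its invariants in terms of `N`. -/
lemma exists_spPair (hnd : ∀ x : V, (∀ y : V, B x y = 0) → x = 0) {N : V →ₗ[k] V}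
    (hN : IsNilpotent N) (hsp : ∀ x y : V, B (N x) y + B x (N y) + B (N x) (N y) = 0) :
    ∃ s : End k V, SpPair B s N ∧ (∀ i, LinearMap.ker (s ^ i) = LinearMap.ker (N ^ (2 * i))) ∧
      (∀ i, LinearMap.ker (s ^ i * N) = LinearMap.ker (N ^ (2 * i + 1))) ∧
      ∀ i, Eps B s N i ↔ ∃ x, (N ^ (2 * i + 1 + 1)) x = 0 ∧ B x ((N ^ (2 * i + 1)) x) ≠ 0 := by
  obtain ⟨u, hu⟩ := hN.isUnit_one_add
  obtain ⟨P, hP1, hP2⟩ : ∃ P : End k V, P * (1 + N) = 1 ∧ (1 + N) * P = 1 :=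
    ⟨↑u⁻¹, by rw [← hu]; simp, by rw [← hu]; simp⟩
  have hcomm : Commute P N := by
    rw [mul_add, mul_one] at hP1
    rw [add_mul, one_mul] at hP2
    exact add_left_cancel (hP1.trans hP2.symm)
  have hNP : N * P = 1 - P := by rw [← hP2]; noncomm_ring
  have hs : P * N ^ 2 - N = P - 1 := by
    rw [(hcomm.pow_right 2).eq, sq, mul_assoc, hNP, mul_sub, hNP]
    noncomm_ring
  have hsi : ∀ i, (P * N ^ 2) ^ i = P ^ i * N ^ (2 * i) := fun i => by
    rw [(hcomm.pow_right 2).mul_pow, pow_mul]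
  have hinj : ∀ i x, (P ^ i) x = 0 → x = 0 := fun i x hx => by
    have h : (1 + N) ^ i * P ^ i = 1 := by
      rw [← (show Commute (1 + N) P from hP2.trans hP1.symm).mul_pow, hP2, one_pow]
    have := LinearMap.congr_fun h x
    rw [End.mul_apply, hx, map_zero] at this
    exact this.symm
  have hker : ∀ i (T : End k V), LinearMap.ker (P ^ i * T) = LinearMap.ker T := fun i T => by
    ext x
    simp only [LinearMap.mem_ker, End.mul_apply]
    exact ⟨hinj i _, fun h => by rw [h, map_zero]⟩
  have hsiN : ∀ i, (P * N ^ 2) ^ i * N = P ^ i * N ^ (2 * i + 1) := fun i => by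
    rw [hsi, mul_assoc, pow_succ]
  have hiso : ∀ x y, B ((1 + N) x) ((1 + N) y) = B x y := fun x y => by
    simp only [LinearMap.add_apply, End.one_apply, map_add]
    linear_combination hsp x y
  have hP1' : ∀ x, P ((1 + N) x) = x := LinearMap.congr_fun hP1
  have hP2' : ∀ x, (1 + N) (P x) = x := LinearMap.congr_fun hP2
  have hs' : ∀ y, (P * N ^ 2) y = P y - y + N y := fun y => by
    have := LinearMap.congr_fun hs y
    simp only [LinearMap.sub_apply, End.one_apply] at this
    rw [← this]; abel
  have hadj : ∀ x y, B (N x) y = B x (P y) - B x y := fun x y => by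
    rw [← hiso x (P y), hP2']
    simp
  have hadjP : ∀ x y, B (P x) y = B x (N y) + B x y := fun x y => by
    rw [← hiso (P x) y, hP2']
    simp [add_comm]
  refine ⟨P * N ^ 2, ⟨halt, hnd, ?_, ?_, ?_, ?_, ?_⟩, ?_, ?_, ?_⟩
  · obtain ⟨n, hn⟩ := hN
    exact ⟨n, by rw [hsi, two_mul, pow_add, hn]; simp⟩
  · have : Commute N (P * N ^ 2) := hcomm.symm.mul_right (Commute.self_pow N 2)
    exact LinearMap.congr_fun this.eq
  · have : N * N = P * N ^ 2 * N + P * N ^ 2 := by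
      rw [← mul_add_one, mul_assoc, ((Commute.refl N).add_right (Commute.one_right N)).pow_left 2,
        ← mul_assoc, add_comm N, hP1, one_mul, sq]
    exact LinearMap.congr_fun this
  · intro x y
    rw [hs', hs']
    simp only [map_add, map_sub, LinearMap.add_apply, LinearMap.sub_apply, hadj, hadjP]
    ring
  · intro x y
    rw [hadj, hs', map_add, map_sub]
    ring
  · intro i
    rw [hsi, hker]
  · intro i
    rw [hsiN, hker]
  · intro i
    have hfix : ∀ j x, N x = 0 → (P ^ j) x = x := fun j x hx => by
      induction j with
      | zero => simp
      | succ j ih =>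
        have := hP1' x
        rw [LinearMap.add_apply, hx, add_zero, End.one_apply] at this
        rw [pow_succ, End.mul_apply, this, ih]
    refine exists_congr fun x => ?_
    have h1 : ((P * N ^ 2) ^ (i + 1)) x = 0 ↔ (N ^ (2 * i + 1 + 1)) x = 0 := by
      rw [← LinearMap.mem_ker, hsi, hker, LinearMap.mem_ker,
        show 2 * (i + 1) = 2 * i + 1 + 1 by ring]
    rw [h1]
    refine and_congr_right fun hx => ?_
    have h2 : ((P * N ^ 2) ^ i) (N x) = (N ^ (2 * i + 1)) x := by
      rw [← End.mul_apply, hsiN, End.mul_apply]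
      refine hfix _ _ ?_
      rwa [← End.mul_apply, ← pow_succ']
    rw [h2]

end Filtration

/-- if `1+N, 1+N' ∈ Sp(⟨,⟩)` have the same canonical filtration and
induce the same maps on its graded pieces (`N − N' ∈ E_{≥3}V^N_*`), then they are
conjugate by an element `g ∈ Sp(⟨,⟩)` preserving the filtration. -/
theorem stmt_19
    (k : Type*) [Field k] [IsAlgClosed k]
    (V : Type*) [AddCommGroup V] [Module k V]
    [FiniteDimensional k V]
    (B : V →ₗ[k] V →ₗ[k] k)
    (halt : ∀ x : V, B x x = 0)
    (hnd : ∀ x : V, (∀ y : V, B x y = 0) → x = 0)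
    (N N' : V →ₗ[k] V) (hN : IsNilpotent N) (hN' : IsNilpotent N')
    (hspN : ∀ x y : V, B (N x) y + B x (N y) + B (N x) (N y) = 0)
    (hspN' : ∀ x y : V, B (N' x) y + B x (N' y) + B (N' x) (N' y) = 0)
    (hfilt : ∀ a : ℤ, canonFilt N a = canonFilt N' a)
    (hdiff : ∀ a : ℤ, ∀ x ∈ canonFilt N a, N x - N' x ∈ canonFilt N (a + 3)) :
    ∃ g : V ≃ₗ[k] V,
      (∀ x y : V, B (g x) (g y) = B x y) ∧
      (∀ a : ℤ, Submodule.map g.toLinearMap (canonFilt N a) = canonFilt N a) ∧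
      (∀ x : V, N' x = g (N (g.symm x))) := by
  obtain ⟨s, H, hev, hod, heps⟩ := exists_spPair halt hnd hN hspN
  obtain ⟨s', H', hev', hod', heps'⟩ := exists_spPair halt hnd hN' hspN'
  have hfin : ∀ n, Module.finrank k (LinearMap.ker (N ^ n)) =
      Module.finrank k (LinearMap.ker (N' ^ n)) := fun n => by
    have h1 := finrank_ker_pow_add N n
    have h2 := finrank_ker_pow_add N' n
    rw [← hfilt, ← hfilt] at h2
    omega
  have hdiff' : ∀ a : ℤ, ∀ x ∈ canonFilt N' a, N' x - N x ∈ canonFilt N' (a + 3) := by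
    intro a x hx
    rw [← hfilt] at hx ⊢
    rw [← neg_sub, neg_mem_iff]
    exact hdiff a x hx
  obtain ⟨e, -, heN, heB⟩ := SameType.spIso H H' ⟨fun i => by rw [hev, hev', hfin],
    fun i => by rw [hod, hod', hfin], fun i => by
      rw [heps, heps']
      exact ⟨exists_top_ne_zero_of_canonFilt_eq halt hspN hfilt hdiff,
        exists_top_ne_zero_of_canonFilt_eq halt hspN' (fun a => (hfilt a).symm) hdiff'⟩⟩
  have heN' : ∀ x, e.symm (N' x) = N (e.symm x) := fun x => by
    rw [LinearEquiv.symm_apply_eq, heN, e.apply_symm_apply]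
  refine ⟨e, heB, fun a => le_antisymm ?_ ?_, fun x => by rw [heN, e.apply_symm_apply]⟩
  · exact (map_canonFilt_le heN a).trans (hfilt a).ge
  · intro x hx
    refine ⟨e.symm x, ?_, e.apply_symm_apply x⟩
    rw [hfilt] at hx
    exact map_canonFilt_le (e := e.symm.toLinearMap) heN' a ⟨x, hx, rfl⟩
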